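/- Let f_1, f_2 ∈ B_6 and let f = f_1||f_2 ∈ B_7. If nl_2(f_1) = 15 and nl_2(f_2) = 15, then nl_2(f) ≤ 40. -/

import Mathlib

open scoped BigOperators

/-- Boolean functions in `n` variables. -/
abbrev BF (n : ℕ) := (Fin n → ZMod 2) → ZMod 2

/-- Hamming distance between two Boolean functions. -/
def hd {n : ℕ} (f g : BF n) : ℕ :=
  (Finset.univ.filter (fun x : Fin n → ZMod 2 => f x ≠ g x)).card

/-- The Reed--Muller code `RM(r,n)`: Boolean functions given by evaluation of a
multivariate polynomial over `F_2` of total degree at most `r`. -/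
def RM (r n : ℕ) : Set (BF n) :=
  {f | ∃ p : MvPolynomial (Fin n) (ZMod 2),
    p.totalDegree ≤ r ∧ ∀ x, f x = MvPolynomial.eval x p}

/-- The `r`-th order nonlinearity of a Boolean function. -/
noncomputable def nl (r : ℕ) {n : ℕ} (f : BF n) : ℕ :=
  sInf {d | ∃ g ∈ RM r n, d = hd f g}

/-- Concatenation `f1 || f2` of two Boolean functions. -/
def concat {n : ℕ} (f1 f2 : BF n) : BF (n + 1) :=
  fun x => (1 + x (Fin.last n)) * f1 (x ∘ Fin.castSucc)
    + x (Fin.last n) * f2 (x ∘ Fin.castSucc)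

/-- A Boolean function is homogeneous quadratic if it is of the form
`∑_{i<j} a_{ij} x_i x_j`. -/
def HomQuad {n : ℕ} (g : BF n) : Prop :=
  ∃ a : Fin n → Fin n → ZMod 2,
    ∀ x, g x = ∑ i : Fin n, ∑ j : Fin n, (if i < j then a i j * x i * x j else 0)

/-- `Fh f r` is the set of homogeneous quadratic functions `g` with `nl(f+g) = r`. -/
def Fh {n : ℕ} (f : BF n) (r : ℕ) : Set (BF n) :=
  {g | HomQuad g ∧ nl 1 (f + g) = r}

/-- `NFh f r = |Fh f r|`. -/
noncomputable def NFh {n : ℕ} (f : BF n) (r : ℕ) : ℕ := (Fh f r).ncard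

/-- The set of 6-variable Boolean functions with nonlinearity 16. -/
def S16 : Set (BF 6) := {f | nl 1 f = 16}

/-- `f1` and `f2` are affine equivalent modulo `RM(r,n)`. -/
def AffEquivMod (r n : ℕ) (f1 f2 : BF n) : Prop :=
  ∃ A : Matrix (Fin n) (Fin n) (ZMod 2), IsUnit A ∧ ∃ b : Fin n → ZMod 2,
    (fun x => f1 x + f2 (A.mulVec x + b)) ∈ RM r n

def fun1 : BF 6 := fun x => x 0*x 1*x 5 + x 0*x 2*x 4 + x 1*x 2*x 3

def fun2 : BF 6 := fun x => x 0*x 1*x 2*x 3 + x 0*x 1*x 5 + x 0*x 3*x 4 + x 1*x 2*x 4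

def fun3 : BF 6 := fun x => x 0*x 1*x 2*x 3 + x 0*x 2*x 4 + x 0*x 3*x 5 + x 1*x 2*x 4
  + x 1*x 2*x 5 + x 1*x 3*x 4

def fun4 : BF 6 := fun x => x 0*x 1*x 2*x 5 + x 0*x 1*x 3*x 4 + x 0*x 2*x 4
  + x 0*x 3*x 4 + x 0*x 3*x 5 + x 1*x 2*x 3

def fun5 : BF 6 := fun x => x 0*x 1*x 2*x 3*x 4 + x 0*x 2*x 4 + x 0*x 3*x 5
  + x 1*x 2*x 4 + x 1*x 2*x 5 + x 1*x 3*x 4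

def fun6 : BF 6 := fun x => x 0*x 1*x 2*x 3*x 4*x 5 + x 0*x 1*x 5 + x 0*x 2*x 4
  + x 1*x 2*x 3

def fun7 : BF 6 := fun x => x 0*x 1*x 2*x 3*x 4*x 5 + x 0*x 1*x 2*x 3 + x 0*x 1*x 5
  + x 0*x 3*x 4 + x 1*x 2*x 4 + x 3*x 4

def fun8 : BF 6 := fun x => x 0*x 1*x 2*x 3*x 4*x 5 + x 0*x 1*x 2*x 3 + x 0*x 2*x 4
  + x 0*x 3*x 5 + x 1*x 2*x 4 + x 1*x 2*x 5 + x 1*x 3*x 4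

def fun9 : BF 6 := fun x => x 0*x 1*x 2*x 3*x 4*x 5 + x 0*x 1*x 2*x 5 + x 0*x 1*x 3*x 4
  + x 0*x 2*x 4 + x 0*x 3*x 4 + x 0*x 3*x 5 + x 1*x 2*x 3 + x 3*x 5

def fun10 : BF 6 := fun x => x 0*x 1*x 2*x 3*x 4*x 5 + x 0*x 1*x 2*x 3 + x 0*x 2*x 3
  + x 0*x 4*x 5 + x 1*x 2*x 3 + x 1*x 2*x 5 + x 1*x 3*x 4 + x 2*x 3 + x 2*x 5 + x 3*x 4

def fun11 : BF 6 := fun x => x 0*x 1*x 2*x 3*x 4*x 5 + x 0*x 1*x 2*x 5 + x 0*x 1*x 3*x 4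
  + x 0*x 2*x 4 + x 0*x 3*x 4 + x 0*x 3*x 5 + x 1*x 2*x 3 + x 1*x 2*x 5 + x 1*x 3*x 4
  + x 2*x 4 + x 3*x 4 + x 3*x 5

def fun12 : BF 6 := fun x => x 0*x 1*x 2*x 3*x 4*x 5 + x 1*x 2*x 3*x 4 + x 0*x 1*x 4*x 5
  + x 0*x 2*x 3*x 5 + x 0*x 1*x 3 + x 0*x 1*x 4 + x 1*x 2*x 4 + x 2*x 3*x 4
  + x 0*x 1*x 5 + x 2*x 3*x 5

def g0 : BF 6 := fun x => x 0*x 1*x 2 + x 0*x 3*x 4 + x 1*x 3*x 5 + x 2*x 4*x 5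
  + x 3*x 4*x 5

/-! ### Discrete derivatives and degree -/

/-- The derivative of `f` in direction `t`. -/
def bder {n : ℕ} (t : Fin n → ZMod 2) (f : BF n) : BF n := fun x => f (x + t) + f x

/-- `DegLT k f` says that all `k`-fold derivatives of `f` vanish, i.e. that `f` has algebraic
degree less than `k`. -/
def DegLT {n : ℕ} : ℕ → BF n → Prop
  | 0, f => f = 0
  | k + 1, f => ∀ t, DegLT k (bder t f)

/-- A map that is affine over `F_2`. -/
def IsAff {n m : ℕ} (σ : (Fin n → ZMod 2) → (Fin m → ZMod 2)) : Prop :=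
  ∀ x t, σ (x + t) = σ x + (σ t + σ 0)

section Degree

variable {n m : ℕ}

lemma bf_add_self (f : BF n) : f + f = 0 := funext fun _ => CharTwo.add_self_eq_zero _

lemma vec_add_self (x : Fin n → ZMod 2) : x + x = 0 := funext fun _ => CharTwo.add_self_eq_zero _

lemma bder_add (t : Fin n → ZMod 2) (f g : BF n) : bder t (f + g) = bder t f + bder t g := by
  funext x; simp only [bder, Pi.add_apply]; ring

lemma bder_zero (t : Fin n → ZMod 2) : bder t (0 : BF n) = 0 := by
  funext x; simp [bder]

lemma DegLT.zero (k : ℕ) : DegLT k (0 : BF n) := by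
  induction k with
  | zero => rfl
  | succ k ih => intro t; rw [bder_zero]; exact ih

lemma DegLT.add {k : ℕ} {f g : BF n} (hf : DegLT k f) (hg : DegLT k g) : DegLT k (f + g) := by
  induction k generalizing f g with
  | zero => simp only [DegLT] at *; simp [hf, hg]
  | succ k ih => intro t; rw [bder_add]; exact ih (hf t) (hg t)

lemma DegLT.of_add {k : ℕ} {f g : BF n} (hf : DegLT k (f + g)) (hg : DegLT k g) : DegLT k f := by
  have := hf.add hg
  rwa [add_assoc, bf_add_self, add_zero] at this

lemma DegLT.succ {k : ℕ} {f : BF n} (hf : DegLT k f) : DegLT (k + 1) f := by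
  induction k generalizing f with
  | zero => simp only [DegLT] at hf; rw [hf]; exact DegLT.zero _
  | succ k ih => intro t; exact ih (hf t)

lemma DegLT.mono {k l : ℕ} {f : BF n} (hf : DegLT k f) (h : k ≤ l) : DegLT l f := by
  induction l, h using Nat.le_induction with
  | base => exact hf
  | succ l _ ih => exact ih.succ

lemma DegLT.bder {k : ℕ} {f : BF n} (hf : DegLT (k + 1) f) (t : Fin n → ZMod 2) :
    DegLT k (bder t f) := hf t

lemma bder_comp {σ : (Fin n → ZMod 2) → (Fin m → ZMod 2)} (hσ : IsAff σ) (f : BF m)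
    (t : Fin n → ZMod 2) : bder t (f ∘ σ) = bder (σ t + σ 0) f ∘ σ := by
  funext x; simp only [_root_.bder, Function.comp, hσ x t]

lemma DegLT.comp {k : ℕ} {f : BF m} (hf : DegLT k f) {σ : (Fin n → ZMod 2) → (Fin m → ZMod 2)}
    (hσ : IsAff σ) : DegLT k (f ∘ σ) := by
  induction k generalizing f with
  | zero => simp only [DegLT] at *; subst hf; rfl
  | succ k ih => intro t; rw [bder_comp hσ]; exact ih (hf _)

lemma isAff_translate (t : Fin n → ZMod 2) : IsAff (fun x => x + t) := by
  intro x s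
  have h := vec_add_self t
  show x + s + t = x + t + (s + t + (0 + t))
  rw [zero_add, add_assoc s, h, add_zero]; abel

lemma DegLT.translate {k : ℕ} {f : BF n} (hf : DegLT k f) (t : Fin n → ZMod 2) :
    DegLT k (fun x => f (x + t)) := hf.comp (isAff_translate t)

lemma DegLT.mul {a b : ℕ} {f g : BF n} (hf : DegLT (a + 1) f) (hg : DegLT (b + 1) g) :
    DegLT (a + b + 1) (f * g) := by
  induction h : a + b generalizing a b f g with
  | zero =>
    obtain ⟨rfl, rfl⟩ : a = 0 ∧ b = 0 := by omega
    intro t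
    have h1 := hf t
    have h2 := hg t
    simp only [DegLT] at *
    funext x
    have h1 := congrFun h1 x
    have h2 := congrFun h2 x
    simp only [_root_.bder, Pi.mul_apply, Pi.zero_apply] at *
    rw [CharTwo.add_eq_zero] at *
    rw [h1, h2]
  | succ c ih =>
    intro t
    have e : _root_.bder t (f * g)
        = (fun x => f (x + t)) * _root_.bder t g + _root_.bder t f * g := by
      funext x
      simp only [_root_.bder, Pi.mul_apply, Pi.add_apply]
      linear_combination (-f (x + t) * g x) * CharTwo.two_eq_zero (R := ZMod 2)
    rw [e]
    refine DegLT.add ?_ ?_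
    · cases b with
      | zero =>
        have : _root_.bder t g = 0 := hg t
        rw [this, mul_zero]; exact DegLT.zero _
      | succ b => exact ih (hf.translate t) (hg t) (by omega)
    · cases a with
      | zero =>
        have : _root_.bder t f = 0 := hf t
        rw [this, zero_mul]; exact DegLT.zero _
      | succ a => exact ih (hf t) hg (by omega)

lemma degLT_const (c : ZMod 2) : DegLT 1 (fun _ : Fin n → ZMod 2 => c) := by
  intro t; funext x; exact CharTwo.add_self_eq_zero c

lemma degLT_coord (i : Fin n) : DegLT 2 (fun x : Fin n → ZMod 2 => x i) := by
  intro t s; funext x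
  simp only [bder, Pi.add_apply, Pi.zero_apply]
  linear_combination (2 * x i + s i + t i) * CharTwo.two_eq_zero (R := ZMod 2)

lemma degLT_monomial (s : Multiset (Fin n)) :
    DegLT (s.card + 1) (fun x : Fin n → ZMod 2 => (s.map x).prod) := by
  induction s using Multiset.induction with
  | empty => simpa using degLT_const 1
  | cons i s ih =>
    have := (degLT_coord i).mul ih
    simp only [Multiset.map_cons, Multiset.prod_cons, Multiset.card_cons]
    rw [show s.card + 1 + 1 = 1 + s.card + 1 by omega]
    exact this

lemma eval_eq_sum_monomial (p : MvPolynomial (Fin n) (ZMod 2)) (x : Fin n → ZMod 2) :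
    MvPolynomial.eval x p
      = ∑ d ∈ p.support, p.coeff d * ((Finsupp.toMultiset d).map x).prod := by
  rw [MvPolynomial.eval_eq]
  refine Finset.sum_congr rfl fun d _ => ?_
  rw [Finsupp.toMultiset_map, Finsupp.prod_toMultiset, Finsupp.prod_mapDomain_index
    (by simp) (by intros; rw [pow_add])]
  rfl

/-- Splitting a function along the last coordinate. -/
lemma split_last (f : BF (n + 1)) (x : Fin (n + 1) → ZMod 2) :
    f x = f (Fin.snoc (Fin.init x) 0)
      + x (Fin.last n) * bder (Pi.single (Fin.last n) 1) f (Fin.snoc (Fin.init x) 0) := by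
  have e : (Fin.snoc (Fin.init x) 0 : Fin (n + 1) → ZMod 2) + Pi.single (Fin.last n) 1
      = Fin.snoc (Fin.init x) 1 := by
    funext i
    refine Fin.lastCases ?_ (fun j => ?_) i
    · simp
    · simp [Fin.castSucc_ne_last]
  have hx : x = Fin.snoc (Fin.init x) (x (Fin.last n)) := (Fin.snoc_init_self x).symm
  simp only [bder, e]
  generalize ha : x (Fin.last n) = a at hx ⊢
  have : a = 0 ∨ a = 1 := (by decide : ∀ a : ZMod 2, a = 0 ∨ a = 1) a
  rcases this with rfl | rfl
  · rw [zero_mul, add_zero, ← hx]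
  · rw [one_mul, ← hx]
    linear_combination (-f (Fin.snoc (Fin.init x) 0)) * CharTwo.two_eq_zero (R := ZMod 2)

lemma isAff_snoc_zero : IsAff (fun x : Fin n → ZMod 2 => (Fin.snoc x 0 : Fin (n + 1) → ZMod 2)) := by
  intro x t
  funext i
  refine Fin.lastCases ?_ (fun j => ?_) i <;> simp

lemma isAff_init : IsAff (fun x : Fin (n + 1) → ZMod 2 => (Fin.init x : Fin n → ZMod 2)) := by
  intro x t
  funext i
  simp [Fin.init]

lemma degLT_of_split {k : ℕ} {f₀ f₁ : BF n} (h₀ : DegLT (k + 1) f₀) (h₁ : DegLT k f₁) :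
    DegLT (k + 1) (fun x : Fin (n + 1) → ZMod 2 =>
      f₀ (Fin.init x) + x (Fin.last n) * f₁ (Fin.init x)) := by
  refine DegLT.add (h₀.comp isAff_init) ?_
  cases k with
  | zero =>
    have : f₁ = 0 := h₁
    subst this
    convert DegLT.zero (n := n + 1) 1 using 1
    funext x; simp
  | succ k =>
    have := (degLT_coord (Fin.last n)).mul (h₁.comp isAff_init)
    rw [show k + 1 + 1 = 1 + k + 1 by omega]
    exact this

theorem mem_RM_iff {r : ℕ} {f : BF n} : f ∈ RM r n ↔ DegLT (r + 1) f := by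
  constructor
  · rintro ⟨p, hp, hf⟩
    have : f = ∑ d ∈ p.support, fun x => p.coeff d * ((Finsupp.toMultiset d).map x).prod := by
      funext x; rw [hf, eval_eq_sum_monomial, Finset.sum_apply]
    rw [this]
    refine Finset.sum_induction _ (DegLT (r + 1)) (fun _ _ => DegLT.add) (DegLT.zero _) ?_
    intro d hd
    have h := (degLT_const (n := n) (p.coeff d)).mul (degLT_monomial (Finsupp.toMultiset d))
    refine h.mono ?_
    have : d.sum (fun _ => id) ≤ p.totalDegree := MvPolynomial.le_totalDegree hd
    rw [Finsupp.card_toMultiset]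
    omega
  · intro h
    induction n generalizing r with
    | zero =>
      exact ⟨MvPolynomial.C (f 0), by simp, fun x => by simp [Subsingleton.elim x 0]⟩
    | succ n ih =>
      obtain ⟨p₀, hp₀, h₀⟩ := ih (h.comp isAff_snoc_zero)
      cases r with
      | zero =>
        refine ⟨MvPolynomial.rename Fin.castSucc p₀,
          (MvPolynomial.totalDegree_rename_le _ _).trans hp₀, fun x => ?_⟩
        have h1 : bder (Pi.single (Fin.last n) 1) f = 0 := h _
        rw [split_last f x, h1, MvPolynomial.eval_rename]
        have e : f (Fin.snoc (Fin.init x) 0) = _ := h₀ (Fin.init x)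
        rw [e, Pi.zero_apply, mul_zero, add_zero]
        rfl
      | succ r =>
        obtain ⟨p₁, hp₁, h₁⟩ := ih ((h.bder (Pi.single (Fin.last n) 1)).comp isAff_snoc_zero)
        refine ⟨MvPolynomial.rename Fin.castSucc p₀
          + MvPolynomial.X (Fin.last n) * MvPolynomial.rename Fin.castSucc p₁, ?_, fun x => ?_⟩
        · refine (MvPolynomial.totalDegree_add _ _).trans (max_le ?_ ?_)
          · exact (MvPolynomial.totalDegree_rename_le _ _).trans hp₀
          · refine (MvPolynomial.totalDegree_mul _ _).trans ?_
            have := MvPolynomial.totalDegree_rename_le (Fin.castSucc : Fin n → _) p₁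
            rw [MvPolynomial.totalDegree_X]
            omega
        · rw [split_last f x]
          simp only [map_add, map_mul, MvPolynomial.eval_rename, MvPolynomial.eval_X]
          exact congrArg₂ _ (h₀ (Fin.init x)) (congrArg _ (h₁ (Fin.init x)))

lemma DegLT.induction {k : ℕ} {P : BF n → Prop} (h0 : P 0) (hadd : ∀ f g, P f → P g → P (f + g))
    (hmon : ∀ s : Multiset (Fin n), s.card ≤ k → P (fun x => (s.map x).prod))
    {f : BF n} (hf : DegLT (k + 1) f) : P f := by
  obtain ⟨p, hp, hf⟩ := mem_RM_iff.2 hf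
  have : f = ∑ d ∈ p.support, fun x => p.coeff d * ((Finsupp.toMultiset d).map x).prod := by
    funext x; rw [hf, eval_eq_sum_monomial, Finset.sum_apply]
  rw [this]
  refine Finset.sum_induction _ P hadd h0 fun d hd => ?_
  have hc : ∀ c : ZMod 2, c = 0 ∨ c = 1 := by decide
  rcases hc (p.coeff d) with h | h
  · simp only [h, zero_mul]
    exact h0
  · simp only [h, one_mul]
    refine hmon _ ?_
    have : d.sum (fun _ => id) ≤ p.totalDegree := MvPolynomial.le_totalDegree hd
    rw [Finsupp.card_toMultiset]
    omega

lemma sum_split_last {M : Type*} [AddCommMonoid M] (f : (Fin (n + 1) → ZMod 2) → M) :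
    ∑ x, f x = ∑ x : Fin n → ZMod 2, (f (Fin.snoc x 0) + f (Fin.snoc x 1)) := by
  rw [← (Fin.snocEquiv fun _ => ZMod 2).sum_comp, Fintype.sum_prod_type, Finset.sum_comm]
  exact Finset.sum_congr rfl fun x _ => Fin.sum_univ_two _

lemma sum_eq_zero_of_degLT {f : BF n} (hf : DegLT n f) : ∑ x, f x = 0 := by
  induction n with
  | zero => rw [show f = 0 from hf]; simp
  | succ n ih =>
    rw [sum_split_last]
    have := ih ((hf.bder (Pi.single (Fin.last n) 1)).comp isAff_snoc_zero)
    refine Eq.trans (Finset.sum_congr rfl fun x _ => ?_) this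
    have h := split_last f (Fin.snoc x 1)
    simp only [Fin.init_snoc, Fin.snoc_last, one_mul] at h
    rw [Function.comp_apply, h, ← add_assoc, CharTwo.add_self_eq_zero, zero_add]

lemma degLT_all (f : BF n) : DegLT (n + 1) f := by
  induction n with
  | zero =>
    intro t; funext x
    simp [bder, Subsingleton.elim (x + t) x, CharTwo.add_self_eq_zero]
  | succ n ih =>
    have h := degLT_of_split (ih fun x => f (Fin.snoc x 0)).succ
      (ih fun x => bder (Pi.single (Fin.last n) 1) f (Fin.snoc x 0))
    rwa [← funext (split_last f)] at h

/-- The code of functions of degree less than `k` is the dual of that of functions of degree less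
than `n + 1 - k`. -/
theorem degLT_of_orthogonal {k l : ℕ} (hkl : k + l = n + 1) {f : BF n}
    (h : ∀ g : BF n, DegLT l g → ∑ x, f x * g x = 0) : DegLT k f := by
  induction n generalizing k l with
  | zero =>
    rcases k with _ | k
    · obtain rfl : l = 1 := by omega
      have := h _ (degLT_const 1)
      funext x
      rw [Fintype.sum_subsingleton _ x, mul_one] at this
      exact this
    · exact (degLT_all f).mono (by omega)
  | succ n ih =>
    rcases l with _ | l
    · exact (degLT_all f).mono (by omega)
    have h₀ : DegLT k (fun x : Fin n → ZMod 2 => f (Fin.snoc x 0)) := by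
      refine ih (l := l) (by omega) fun g hg => ?_
      have := h (fun x => g (Fin.init x) + x (Fin.last n) * g (Fin.init x))
        (degLT_of_split hg.succ hg)
      rw [sum_split_last] at this
      simpa [CharTwo.add_self_eq_zero] using this
    have h₁ : ∀ g : BF n, DegLT (l + 1) g →
        ∑ x : Fin n → ZMod 2, bder (Pi.single (Fin.last n) 1) f (Fin.snoc x 0) * g x = 0 := by
      intro g hg
      refine Eq.trans ?_ (h (fun x => g (Fin.init x)) (hg.comp isAff_init))
      rw [sum_split_last]
      refine Finset.sum_congr rfl fun x _ => ?_
      have e := split_last f (Fin.snoc x 1)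
      simp only [Fin.init_snoc, Fin.snoc_last, one_mul] at e ⊢
      rw [e, ← add_mul, ← add_assoc, CharTwo.add_self_eq_zero, zero_add]
    rcases k with _ | k
    · have h₁ : DegLT 0 (fun x : Fin n → ZMod 2 =>
          bder (Pi.single (Fin.last n) 1) f (Fin.snoc x 0)) :=
        ih (l := n + 1) (by omega) fun g hg => h₁ g (hg.mono (by omega))
      funext x
      have e₀ := congrFun (show _ = (0 : BF n) from h₀) (Fin.init x)
      have e₁ := congrFun (show _ = (0 : BF n) from h₁) (Fin.init x)
      simp only [Pi.zero_apply] at e₀ e₁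
      rw [split_last f x, e₀, e₁]
      simp
    · have := degLT_of_split h₀ (ih (l := l + 1) (by omega) h₁)
      rwa [← funext (split_last f)] at this

end Degree

/-! ### Weights and the Fourier transform -/

/-- The Hamming weight of a Boolean function. -/
def wt {n : ℕ} (f : BF n) : ℕ := (Finset.univ.filter fun x => f x ≠ 0).card

/-- The sign `(-1)^a`. -/
def sg (a : ZMod 2) : ℤ := if a = 0 then 1 else -1

/-- The sum of the signs of a Boolean function. -/
def signSum {n : ℕ} (f : BF n) : ℤ := ∑ x, sg (f x)

/-- The Fourier transform of an integer-valued function on `F_2^n`. -/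
def hat {n : ℕ} (u : (Fin n → ZMod 2) → ℤ) (a : Fin n → ZMod 2) : ℤ :=
  ∑ x, u x * sg (dotProduct a x)

/-- The autocorrelation of an integer-valued function on `F_2^n`. -/
def autocorr {n : ℕ} (u : (Fin n → ZMod 2) → ℤ) (t : Fin n → ZMod 2) : ℤ := ∑ x, u x * u (x + t)

/-- The indicator function of a point. -/
def pointInd {n : ℕ} (p : Fin n → ZMod 2) : BF n := fun x => if x = p then 1 else 0

section Weight

variable {n : ℕ}

lemma sg_add (a b : ZMod 2) : sg (a + b) = sg a * sg b := by revert a b; decide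

lemma sg_mul_self (a : ZMod 2) : sg a * sg a = 1 := by revert a; decide

lemma sg_eq_or (a : ZMod 2) : sg a = 1 ∨ sg a = -1 := by revert a; decide

lemma sg_eq_val (a : ZMod 2) : sg a = 1 - 2 * (a.val : ℤ) := by revert a; decide

lemma zmod_two_eq (a : ZMod 2) : a = 0 ∨ a = 1 := by revert a; decide

lemma wt_eq_sum (f : BF n) : wt f = ∑ x, (f x).val := by
  rw [wt, Finset.card_filter]
  refine Finset.sum_congr rfl fun x _ => ?_
  generalize f x = a
  revert a; decide

lemma wt_eq_sum_int (f : BF n) : (wt f : ℤ) = ∑ x, ((f x).val : ℤ) := by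
  rw [wt_eq_sum]; push_cast; rfl

lemma hd_eq_wt (f g : BF n) : hd f g = wt (f + g) := by
  rw [hd, wt]
  congr 1
  refine Finset.filter_congr fun x _ => ?_
  rw [Pi.add_apply, ne_eq, ne_eq, CharTwo.add_eq_zero]

lemma wt_cast (f : BF n) : (wt f : ZMod 2) = ∑ x, f x := by
  rw [wt_eq_sum]; push_cast
  exact Finset.sum_congr rfl fun x _ => ZMod.natCast_zmod_val _

lemma wt_even_iff (f : BF n) : Even (wt f) ↔ ∑ x, f x = 0 := by
  rw [← wt_cast, ZMod.natCast_eq_zero_iff_even]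

lemma wt_comp_equiv {m : ℕ} (f : BF m) (σ : (Fin n → ZMod 2) ≃ (Fin m → ZMod 2)) :
    wt (f ∘ σ) = wt f := by
  rw [wt_eq_sum, wt_eq_sum]
  exact σ.sum_comp fun x => (f x).val

lemma wt_add (f g : BF n) : (wt (f + g) : ℤ) = wt f + wt g - 2 * wt (f * g) := by
  simp only [wt_eq_sum_int, Finset.mul_sum, ← Finset.sum_add_distrib, ← Finset.sum_sub_distrib]
  refine Finset.sum_congr rfl fun x _ => ?_
  simp only [Pi.add_apply, Pi.mul_apply]
  generalize f x = a
  generalize g x = b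
  revert a b; decide

lemma signSum_eq (f : BF n) : signSum f = 2 ^ n - 2 * wt f := by
  simp only [signSum, sg_eq_val, Finset.sum_sub_distrib, ← Finset.mul_sum, ← wt_eq_sum_int]
  simp

lemma sum_sg_dot (x : Fin n → ZMod 2) :
    ∑ a : Fin n → ZMod 2, sg (dotProduct a x) = if x = 0 then 2 ^ n else 0 := by
  split_ifs with h
  · subst h; simp [sg]
  · obtain ⟨i, hi⟩ := Function.ne_iff.1 h
    have h1 : x i = 1 := (zmod_two_eq _).resolve_left hi
    have := Equiv.sum_comp (Equiv.addRight (Pi.single i (1 : ZMod 2) : Fin n → ZMod 2))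
      fun a : Fin n → ZMod 2 => sg (dotProduct a x)
    simp only [Equiv.coe_addRight, add_dotProduct, single_dotProduct, h1, sg_add] at this
    rw [← Finset.sum_mul] at this
    have e : sg (1 * 1) = -1 := by decide
    rw [e] at this
    linarith

lemma hat_hat (u : (Fin n → ZMod 2) → ℤ) (p : Fin n → ZMod 2) :
    ∑ a, hat u a * sg (dotProduct a p) = 2 ^ n * u p := by
  simp only [hat, Finset.sum_mul, mul_assoc, ← sg_add, ← dotProduct_add]
  rw [Finset.sum_comm]
  simp only [← Finset.mul_sum, sum_sg_dot]
  rw [Finset.sum_eq_single p]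
  · rw [vec_add_self, if_pos rfl, mul_comm]
  · intro b _ hb
    rw [if_neg, mul_zero]
    intro h
    apply hb
    have := congrArg (· + p) h
    simpa only [add_assoc, vec_add_self, add_zero, zero_add] using this
  · simp

lemma hat_autocorr (u : (Fin n → ZMod 2) → ℤ) (a : Fin n → ZMod 2) :
    hat (autocorr u) a = hat u a ^ 2 := by
  simp only [hat, autocorr, sq]
  rw [Finset.sum_mul_sum]
  simp only [Finset.sum_mul]
  rw [Finset.sum_comm]
  refine Finset.sum_congr rfl fun x _ => ?_
  rw [← Equiv.sum_comp (Equiv.addLeft x) fun y => u x * sg (dotProduct a x) * (u y * sg (dotProduct a y))]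
  refine Finset.sum_congr rfl fun t _ => ?_
  rw [Equiv.coe_addLeft, dotProduct_add, sg_add]
  linear_combination (-u x * u (x + t) * sg (dotProduct a t)) * sg_mul_self (dotProduct a x)

lemma sum_hat_sq (u : (Fin n → ZMod 2) → ℤ) : ∑ a, hat u a ^ 2 = 2 ^ n * ∑ x, u x ^ 2 := by
  have := hat_hat (autocorr u) 0
  simp only [dotProduct_zero, hat_autocorr] at this
  simpa [sg, autocorr, sq] using this

lemma aff_repr {l : BF n} (hl : DegLT 2 l) : ∃ a c, ∀ x, l x = dotProduct a x + c := by
  refine DegLT.induction (k := 1) (P := fun l => ∃ a c, ∀ x, l x = dotProduct a x + c)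
    ⟨0, 0, by simp⟩ ?_ ?_ hl
  · rintro f g ⟨a, c, h⟩ ⟨a', c', h'⟩
    refine ⟨a + a', c + c', fun x => ?_⟩
    rw [Pi.add_apply, h, h', add_dotProduct]; ring
  · intro s hs
    rcases Nat.le_one_iff_eq_zero_or_eq_one.1 hs with h | h
    · rw [Multiset.card_eq_zero.1 h]
      exact ⟨0, 1, by simp⟩
    · obtain ⟨i, rfl⟩ := Multiset.card_eq_one.1 h
      exact ⟨Pi.single i 1, 0, by simp⟩

lemma degLT_dot (a : Fin n → ZMod 2) : DegLT 2 (fun x => dotProduct a x) := by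
  intro t s; funext x
  simp only [bder, dotProduct_add, Pi.zero_apply]
  linear_combination (2 * dotProduct a x + dotProduct a s + dotProduct a t) *
    CharTwo.two_eq_zero (R := ZMod 2)

lemma signSum_add_dot (G : BF n) (a : Fin n → ZMod 2) (c : ZMod 2) :
    signSum (G + fun x => dotProduct a x + c) = hat (fun x => sg (G x)) a * sg c := by
  simp only [signSum, hat, Pi.add_apply, sg_add, Finset.sum_mul, mul_assoc]

lemma dvd_signSum_of_affine {l : BF n} (hl : DegLT 2 l) : (2 ^ n : ℤ) ∣ signSum l := by
  obtain ⟨a, c, h⟩ := aff_repr hl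
  simp only [signSum, h, sg_add, ← Finset.sum_mul, dotProduct_comm a]
  rw [sum_sg_dot]
  split_ifs
  · exact Dvd.intro _ rfl
  · simp

lemma sum_pointInd_mul (p : Fin n → ZMod 2) (g : BF n) : ∑ x, pointInd p x * g x = g p := by
  simp [pointInd]

lemma exists_pointInd_add_degLT {F : BF (n + 1)} (hF : ∑ x, F x = 1) :
    ∃ p, DegLT n (F + pointInd p) := by
  refine ⟨fun i => ∑ x, F x * x i, degLT_of_orthogonal (l := 2) (by omega) fun g hg => ?_⟩
  obtain ⟨a, c, h⟩ := aff_repr hg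
  simp only [Pi.add_apply, add_mul, Finset.sum_add_distrib, sum_pointInd_mul]
  have e : ∑ x, F x * g x = g fun i => ∑ x, F x * x i := by
    simp only [h, mul_add, Finset.sum_add_distrib, ← Finset.sum_mul, hF, one_mul, dotProduct,
      Finset.mul_sum]
    rw [Finset.sum_comm]
    congr 1
    refine Finset.sum_congr rfl fun i _ => Finset.sum_congr rfl fun x _ => by ring
  rw [e, CharTwo.add_self_eq_zero]

/-- A Boolean function in six variables all of whose Walsh coefficients are `8` or `-8`. -/
def IsBent (G : BF 6) : Prop := ∀ l, DegLT 2 l → signSum (G + l) = 8 ∨ signSum (G + l) = -8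

lemma signSum_add_pointInd (G l : BF n) (p : Fin n → ZMod 2) :
    signSum (G + pointInd p + l) = signSum (G + l) - 2 * sg (G p + l p) := by
  have : ∀ x, sg ((G + pointInd p + l) x)
      = sg ((G + l) x) - if x = p then 2 * sg (G x + l x) else 0 := by
    intro x
    simp only [Pi.add_apply, pointInd]
    split_ifs
    · simp only [sg_add, show sg 1 = -1 from rfl]; ring
    · simp
  simp only [signSum, this, Finset.sum_sub_distrib]
  simp

lemma signSum_mod_eight {G l : BF 6} (hG : DegLT 5 G) (hl : DegLT 2 l) :
    signSum G % 4 = 0 ∧ signSum (G + l) % 8 = signSum G % 8 := by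
  have h1 : Even (wt G) := (wt_even_iff _).2 (sum_eq_zero_of_degLT hG.succ)
  have h2 : Even (wt (G * l)) := (wt_even_iff _).2
    (sum_eq_zero_of_degLT (DegLT.mul (a := 4) (b := 1) hG hl))
  have h3 := wt_add G l
  have h4 := dvd_signSum_of_affine hl
  rw [signSum_eq] at h4
  simp only [signSum_eq]
  obtain ⟨u, hu⟩ := h1
  obtain ⟨v, hv⟩ := h2
  obtain ⟨w, hw⟩ := h4
  omega

lemma isBent_of_pointInd {G : BF 6} (hG : DegLT 5 G) {p : Fin 6 → ZMod 2}
    (h : ∀ l, DegLT 2 l → 26 ≤ wt (G + pointInd p + l)) : IsBent G := by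
  set W := hat fun x => sg (G x) with hW
  have hSa : ∀ a c, signSum (G + fun x => dotProduct a x + c) = W a * sg c :=
    fun a c => signSum_add_dot G a c
  have haff : ∀ a c, DegLT 2 (fun x : Fin 6 → ZMod 2 => dotProduct a x + c) :=
    fun a c => (degLT_dot a).add (degLT_const c).succ
  set y : (Fin 6 → ZMod 2) → ℤ := fun a => W a * (sg (G p) * sg (dotProduct a p)) with hy
  have hmod : ∀ a, W a % 8 = signSum G % 8 := fun a => by
    have := (signSum_mod_eight hG (haff a 0)).2
    rwa [hSa, show sg 0 = 1 from rfl, mul_one] at this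
  have h4 := (signSum_mod_eight hG (haff 0 0)).1
  have hyb : ∀ a, -10 ≤ y a ∧ y a ≤ 14 ∧ (y a = W a ∨ y a = -W a) := by
    intro a
    have k : ∀ c, W a * sg c - 2 * (sg (G p) * (sg (dotProduct a p) * sg c)) ≤ 12 := fun c => by
      have h1 := h _ (haff a c)
      have h2 := signSum_eq (G + pointInd p + fun x => dotProduct a x + c)
      rw [signSum_add_pointInd, hSa] at h2
      simp only [sg_add] at h2
      omega
    have k0 := k 0
    have k1 := k 1
    rw [show sg 0 = 1 from rfl] at k0
    rw [show sg 1 = -1 from rfl] at k1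
    simp only [hy]
    rcases sg_eq_or (G p) with e | e <;> rcases sg_eq_or (dotProduct a p) with e' | e' <;>
      rw [e, e'] at k0 k1 ⊢ <;> refine ⟨?_, ?_, ?_⟩ <;> first | linarith | (left; linarith) | (right; linarith)
  have hs1 : ∑ a, y a = 64 := by
    have := hat_hat (fun x => sg (G x)) p
    have e : ∑ a, y a = sg (G p) * ∑ a, hat (fun x => sg (G x)) a * sg (dotProduct a p) := by
      rw [Finset.mul_sum]
      exact Finset.sum_congr rfl fun a _ => by simp only [hy, hW]; ring
    rw [e, this]
    linear_combination 64 * sg_mul_self (G p)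
  have hs2 : ∑ a, y a ^ 2 = 4096 := by
    have := sum_hat_sq (fun x => sg (G x))
    have e : ∑ a, y a ^ 2 = ∑ a, hat (fun x => sg (G x)) a ^ 2 := by
      refine Finset.sum_congr rfl fun a _ => ?_
      rcases (hyb a).2.2 with e | e
      · rw [e]
      · rw [e, neg_sq]
    rw [e, this]
    simp [sq, sg_mul_self]
  have hcase : signSum G % 8 = 0 ∨ signSum G % 8 = 4 := by omega
  rcases hcase with h0 | h0
  · have hall : ∀ a, y a ^ 2 = 64 := by
      have hle : ∀ a ∈ Finset.univ, y a ^ 2 ≤ 64 := fun a _ => by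
        have := hyb a
        have := hmod a
        have : -8 ≤ y a ∧ y a ≤ 8 := by omega
        nlinarith
      intro a
      refine (Finset.sum_eq_sum_iff_of_le hle).1 ?_ a (Finset.mem_univ _)
      rw [hs2]; simp
    intro l hl
    obtain ⟨a, c, e⟩ := aff_repr hl
    rw [funext e, hSa]
    have h8 : (W a * sg c) ^ 2 = 8 ^ 2 := by
      rw [mul_pow, sq (sg c), sg_mul_self, mul_one]
      rcases (hyb a).2.2 with e | e <;> have := hall a <;> rw [e] at this <;> linarith
    rcases sq_eq_sq_iff_eq_or_eq_neg.1 h8 with h | h <;> simp [h]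
  · exfalso
    have hle : ∑ a, (y a - 12) * (y a + 4) ≤ 0 := Finset.sum_nonpos fun a _ => by
      have := hyb a
      have := hmod a
      have : -4 ≤ y a ∧ y a ≤ 12 := by omega
      nlinarith
    have e : ∑ a, (y a - 12) * (y a + 4) = ∑ a, y a ^ 2 - 8 * ∑ a, y a - 48 * 64 := by
      have h64 : ∑ _a : Fin 6 → ZMod 2, (48 : ℤ) = 48 * 64 := by simp
      rw [← h64, Finset.mul_sum, ← Finset.sum_sub_distrib, ← Finset.sum_sub_distrib]
      exact Finset.sum_congr rfl fun a _ => by ring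
    rw [e, hs1, hs2] at hle
    norm_num at hle

lemma signSum_mul_mul (G l₁ l₂ : BF n) :
    signSum G - signSum (G + l₁) - signSum (G + l₂) + signSum (G + (l₁ + l₂))
      = 4 * wt (l₁ * l₂) - 8 * wt (G * (l₁ * l₂)) := by
  simp only [signSum, wt_eq_sum_int, Finset.mul_sum, ← Finset.sum_add_distrib,
    ← Finset.sum_sub_distrib]
  refine Finset.sum_congr rfl fun x _ => ?_
  simp only [Pi.add_apply, Pi.mul_apply]
  generalize G x = a
  generalize l₁ x = b
  generalize l₂ x = c
  revert a b c; decide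

/-- Every polynomial of degree at most two is a sum of products of affine functions. -/
lemma DegLT.induction_quadratic {P : BF n → Prop} (h0 : P 0)
    (hadd : ∀ f g, P f → P g → P (f + g)) (hmul : ∀ l₁ l₂, DegLT 2 l₁ → DegLT 2 l₂ → P (l₁ * l₂))
    {f : BF n} (hf : DegLT 3 f) : P f := by
  refine DegLT.induction (k := 2) h0 hadd (fun s hs => ?_) hf
  obtain h | h | h : s.card = 0 ∨ s.card = 1 ∨ s.card = 2 := by omega
  · rw [Multiset.card_eq_zero.1 h]
    simpa [Pi.mul_def] using hmul _ _ (degLT_const 1).succ (degLT_const 1).succ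
  · obtain ⟨i, rfl⟩ := Multiset.card_eq_one.1 h
    simpa [Pi.mul_def] using hmul _ _ (degLT_coord i) (degLT_const 1).succ
  · obtain ⟨i, j, rfl⟩ := Multiset.card_eq_two.1 h
    simpa [Pi.mul_def] using hmul _ _ (degLT_coord i) (degLT_coord j)

lemma IsBent.degLT {G : BF 6} (hB : IsBent G) : DegLT 4 G := by
  refine degLT_of_orthogonal (l := 3) (by norm_num) fun g hg => ?_
  refine DegLT.induction_quadratic (P := fun g => ∑ x, G x * g x = 0) (by simp) ?_ ?_ hg
  · intro f g hf hg
    simp only [Pi.add_apply, mul_add, Finset.sum_add_distrib, hf, hg, add_zero]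
  · intro l₁ l₂ h₁ h₂
    have e := signSum_mul_mul G l₁ l₂
    have e' := signSum_mul_mul 0 l₁ l₂
    have w0 := hB 0 (DegLT.zero _)
    have w1 := hB _ h₁
    have w2 := hB _ h₂
    have w3 := hB _ (h₁.add h₂)
    have d0 := dvd_signSum_of_affine (DegLT.zero (n := 6) 2)
    have d1 := dvd_signSum_of_affine h₁
    have d2 := dvd_signSum_of_affine h₂
    have d3 := dvd_signSum_of_affine (h₁.add h₂)
    have hz : wt (0 : BF 6) = 0 := by simp [wt]
    rw [zero_mul, hz, zero_add, zero_add, zero_add] at e'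
    rw [add_zero] at w0
    refine (wt_even_iff (G * (l₁ * l₂))).1 ?_
    rw [Nat.even_iff]
    omega

end Weight

/-! ### Cubic functions and words of weight sixteen -/

section WeightSixteen

variable {n : ℕ}

lemma wt_add_pointInd (f : BF n) (p : Fin n → ZMod 2) :
    (wt (f + pointInd p) : ℤ) = wt f + sg (f p) := by
  have h := signSum_add_pointInd f 0 p
  simp only [add_zero, Pi.zero_apply, signSum_eq] at h
  linarith

lemma wt_translate (f : BF n) (t : Fin n → ZMod 2) : wt (fun x => f (x + t)) = wt f :=
  wt_comp_equiv f (Equiv.addRight t)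

lemma exists_wt_eq_sixteen {c : BF 6} (hc : DegLT 4 c) {p : Fin 6 → ZMod 2}
    (h15 : ∀ q, DegLT 3 q → 15 ≤ wt (c + pointInd p + q))
    (hex : ∃ q, DegLT 3 q ∧ wt (c + pointInd p + q) = 15) :
    (∀ q, DegLT 3 q → 16 ≤ wt (c + q)) ∧ ∃ q, DegLT 3 q ∧ wt (c + q) = 16 := by
  have hval : ∀ q, (wt (c + pointInd p + q) : ℤ) = wt (c + q) + sg ((c + q) p) := fun q => by
    rw [← wt_add_pointInd, add_right_comm]
  have heven : ∀ q, DegLT 3 q → Even (wt (c + q)) := fun q hq =>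
    (wt_even_iff _).2 (sum_eq_zero_of_degLT ((hc.add hq.succ).mono (by norm_num)))
  have h16 : ∀ q, DegLT 3 q → 16 ≤ wt (c + q) := by
    intro q hq
    by_contra hlt
    obtain ⟨v, hv⟩ := heven q hq
    have h1 := h15 q hq
    have h2 := hval q
    have h14 : wt (c + q) = 14 := by rcases sg_eq_or ((c + q) p) with e | e <;> omega
    obtain ⟨x₀, hx₀⟩ : ∃ x₀, (c + q) x₀ = 1 := by
      by_contra hne
      push Not at hne
      have : c + q = 0 := funext fun x => (zmod_two_eq _).resolve_right (hne x)
      rw [this] at h14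
      simp [wt] at h14
    set r : BF 6 := fun x => (c + q) (x + (x₀ + p)) with hr
    have hrc : DegLT 3 (r + c) := by
      have e : r + c = bder (x₀ + p) c + fun x => q (x + (x₀ + p)) := by
        funext x
        simp only [hr, bder, Pi.add_apply]; ring
      rw [e]
      exact (hc.bder _).add (hq.translate _)
    have hcr : c + (r + c) = r := by rw [add_left_comm, bf_add_self, add_zero]
    have h3 := h15 _ hrc
    have h4 := hval (r + c)
    rw [hcr] at h4
    have hrp : r p = 1 := by
      simp only [hr]
      rw [add_left_comm, vec_add_self, add_zero, hx₀]
    have h5 : wt r = 14 := (wt_translate (c + q) _).trans h14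
    rw [hrp, show sg 1 = -1 from rfl, h5] at h4
    omega
  refine ⟨h16, ?_⟩
  obtain ⟨q, hq, h⟩ := hex
  refine ⟨q, hq, ?_⟩
  have h1 := h16 q hq
  obtain ⟨v, hv⟩ := heven q hq
  have h2 := hval q
  rcases sg_eq_or ((c + q) p) with e | e <;> omega

lemma signSum_sq (g : BF n) : signSum g ^ 2 = ∑ r, signSum (bder r g) := by
  simp only [signSum, sq, bder, sg_add]
  rw [Finset.sum_mul_sum, Finset.sum_comm]
  conv_rhs => rw [Finset.sum_comm]
  refine Finset.sum_congr rfl fun x _ => ?_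
  rw [← Equiv.sum_comp (Equiv.addLeft x)]
  rfl

lemma signSum_bder (w : BF n) (t : Fin n → ZMod 2) :
    signSum (bder t w) = 2 ^ n - 4 * wt w + 4 * autocorr (fun x => ((w x).val : ℤ)) t := by
  have h : ∀ a b : ZMod 2, sg (b + a)
      = 1 - 2 * (a.val : ℤ) - 2 * (b.val : ℤ) + 4 * ((a.val : ℤ) * (b.val : ℤ)) := by decide
  have h2 : ∑ x, ((w (x + t)).val : ℤ) = wt w := by
    rw [← wt_translate w t, wt_eq_sum_int]
  simp only [signSum, bder, h, Finset.sum_sub_distrib, Finset.sum_add_distrib, ← Finset.mul_sum, h2,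
    ← wt_eq_sum_int, autocorr]
  simp only [Finset.sum_const, Finset.card_univ, Fintype.card_pi, ZMod.card, Finset.prod_const,
    Fintype.card_fin, nsmul_eq_mul]
  push_cast
  ring

lemma bder_add_left_self (w : BF n) (r t : Fin n → ZMod 2) :
    bder (r + t) (bder t w) = bder r (bder t w) := by
  funext x
  have e : x + (r + t) + t = x + r := by rw [add_assoc, add_assoc, vec_add_self, add_zero]
  have e' : x + (r + t) = x + r + t := by abel
  simp only [bder, e]
  rw [e']
  ring

lemma signSum_eq_zero_or {l : BF n} (hl : DegLT 2 l) :
    signSum l = 0 ∨ DegLT 1 l ∧ (signSum l = 2 ^ n ∨ signSum l = -2 ^ n) := by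
  obtain ⟨a, c, h⟩ := aff_repr hl
  by_cases ha : a = 0
  · right
    obtain rfl : l = fun _ => c := funext fun x => by rw [h, ha]; simp
    refine ⟨degLT_const c, ?_⟩
    rcases sg_eq_or c with e | e <;> simp [signSum, e]
  · left
    simp only [signSum, h, sg_add, ← Finset.sum_mul, dotProduct_comm a, sum_sg_dot, if_neg ha,
      zero_mul]

/-- If few second derivatives in direction `t` are constant, then the autocorrelation of a cubic
word of weight sixteen at `t` is `0` or `4`. -/
lemma autocorr_eq_zero_or_four {w : BF 6} (hw : DegLT 4 w) (hwt : wt w = 16)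
    {t : Fin 6 → ZMod 2} (ht : t ≠ 0)
    (hR : ∀ R : Finset (Fin 6 → ZMod 2), (∀ r ∈ R, DegLT 1 (bder r (bder t w))) → R.card < 16) :
    autocorr (fun x => ((w x).val : ℤ)) t = 0 ∨ autocorr (fun x => ((w x).val : ℤ)) t = 4 := by
  classical
  have hN := signSum_bder w t
  have hN0 : 0 ≤ autocorr (fun x => ((w x).val : ℤ)) t := by
    rw [autocorr]
    exact Finset.sum_nonneg fun x _ => mul_nonneg (Int.natCast_nonneg _) (Int.natCast_nonneg _)
  generalize autocorr (fun x => ((w x).val : ℤ)) t = N at hN hN0 ⊢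
  have hN4 : signSum (bder t w) = 4 * N := by rw [hN, hwt]; norm_num
  have hk : ∀ r, ∃ k : ℤ, signSum (bder r (bder t w)) = 64 * k ∧
      k ≤ if DegLT 1 (bder r (bder t w)) then 1 else 0 := by
    intro r
    rcases signSum_eq_zero_or ((hw.bder t).bder r) with h | ⟨h1, h | h⟩
    · exact ⟨0, by rw [h]; norm_num, by split_ifs <;> norm_num⟩
    · exact ⟨1, by rw [h]; norm_num, by rw [if_pos h1]⟩
    · exact ⟨-1, by rw [h]; norm_num, by rw [if_pos h1]; norm_num⟩
  choose k hk1 hk2 using hk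
  have hsq := signSum_sq (bder t w)
  simp only [hk1, hN4, ← Finset.mul_sum] at hsq
  have hle : ∑ r, k r ≤ 15 := by
    refine (Finset.sum_le_sum fun r _ => hk2 r).trans ?_
    rw [Finset.sum_boole]
    have := hR (Finset.univ.filter fun r => DegLT 1 (bder r (bder t w)))
      fun r hr => (Finset.mem_filter.1 hr).2
    exact_mod_cast Nat.lt_succ_iff.1 this
  have heven : (2 : ℤ) ∣ ∑ r, k r := by
    refine (ZMod.intCast_zmod_eq_zero_iff_dvd _ 2).1 ?_
    push_cast
    refine Finset.sum_involution (fun r _ => r + t) (fun r _ => ?_) (fun r _ _ h => ?_)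
      (fun r _ => Finset.mem_univ _) (fun r _ => ?_)
    · have : k (r + t) = k r := by
        have h1 := hk1 (r + t)
        rw [bder_add_left_self, hk1] at h1
        linarith
      rw [this, CharTwo.add_self_eq_zero]
    · exact ht (left_eq_add.1 h.symm)
    · rw [add_assoc, vec_add_self, add_zero]
  obtain ⟨s, hs⟩ := heven
  have h1 : N ^ 2 = 4 * ∑ r, k r := by linarith
  have h2 : N ≤ 7 := by nlinarith
  rw [hs] at h1 hle
  interval_cases N <;> omega

lemma exists_many_constant_derivatives {w : BF 6} (hw : DegLT 4 w) (hwt : wt w = 16) :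
    ∃ t ≠ 0, ∃ R : Finset (Fin 6 → ZMod 2), 16 ≤ R.card ∧
      ∀ r ∈ R, DegLT 1 (bder r (bder t w)) := by
  by_contra hcon
  push Not at hcon
  set u : (Fin 6 → ZMod 2) → ℤ := fun x => ((w x).val : ℤ) with hu
  have husq : ∀ x, u x ^ 2 = u x := fun x => by
    simp only [hu]
    generalize w x = a
    revert a; decide
  have husum : ∑ x, u x = 16 := by rw [← wt_eq_sum_int, hwt]; rfl
  have hac : ∀ t, t ≠ 0 → autocorr u t = 0 ∨ autocorr u t = 4 := fun t ht =>
    autocorr_eq_zero_or_four hw hwt ht fun R hR => by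
      by_contra hlt
      obtain ⟨r, hr, h⟩ := hcon t ht R (not_lt.1 hlt)
      exact h (hR r hr)
  have hac0 : autocorr u 0 = 16 := by
    simp only [autocorr, add_zero, ← sq, husq, husum]
  have hat0 : hat u 0 = 16 := by
    simp only [hat, zero_dotProduct, show sg 0 = 1 from rfl, mul_one, husum]
  have hacsum : ∑ t, autocorr u t = 256 := by
    have := hat_autocorr u 0
    rw [hat0] at this
    simp only [hat, zero_dotProduct, show sg 0 = 1 from rfl, mul_one] at this
    rw [this]; norm_num
  have hacsq : ∑ t, autocorr u t ^ 2 = 1216 := by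
    have e : ∀ t, autocorr u t ^ 2 = 4 * autocorr u t + if t = 0 then 192 else 0 := by
      intro t
      split_ifs with h
      · rw [h, hac0]; norm_num
      · rcases hac t h with h | h <;> rw [h] <;> norm_num
    simp only [e, Finset.sum_add_distrib, ← Finset.mul_sum, hacsum]
    simp
  have hp2 : ∑ a, hat u a ^ 2 = 1024 := by
    rw [sum_hat_sq]; simp only [husq, husum]; norm_num
  have hp4 : ∑ a, hat u a ^ 4 = 77824 := by
    have := sum_hat_sq (autocorr u)
    simp only [hat_autocorr, hacsq, ← pow_mul] at this
    rw [this]; norm_num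
  have heven : ∀ a, ∃ h : ℕ, wt (w * fun x => dotProduct a x) = h + h := fun a =>
    (wt_even_iff _).2 (sum_eq_zero_of_degLT
      ((DegLT.mul (a := 3) (b := 1) hw (degLT_dot a)).mono (by norm_num)))
  choose h hh using heven
  have hhat : ∀ a, hat u a = 4 * (4 - (h a : ℤ)) := by
    intro a
    have e : hat u a = wt w - 2 * wt (w * fun x => dotProduct a x) := by
      simp only [hat, wt_eq_sum_int, Finset.mul_sum, ← Finset.sum_sub_distrib, hu]
      refine Finset.sum_congr rfl fun x _ => ?_
      simp only [Pi.mul_apply]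
      generalize w x = b
      generalize dotProduct a x = c
      revert b c; decide
    rw [e, hh, hwt]; push_cast; ring
  have hadd : ∀ a b, ((h (a + b) : ℕ) : ZMod 2) = h a + h b := by
    intro a b
    have e := wt_add (w * fun x => dotProduct a x) (w * fun x => dotProduct b x)
    have e1 : ((w * fun x => dotProduct a x) + w * fun x => dotProduct b x)
        = w * fun x => dotProduct (a + b) x := by
      funext x; simp only [Pi.add_apply, Pi.mul_apply, add_dotProduct]; ring
    have e2 : Even (wt ((w * fun x => dotProduct a x) * (w * fun x => dotProduct b x))) := by
      refine (wt_even_iff _).2 (sum_eq_zero_of_degLT ?_)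
      have := DegLT.mul (a := 3) (b := 2) hw (DegLT.mul (a := 1) (b := 1) (degLT_dot a) (degLT_dot b))
      convert this using 1
      funext x
      simp only [Pi.mul_apply]
      rw [mul_mul_mul_comm, (by decide : ∀ b : ZMod 2, b * b = b) (w x)]
    obtain ⟨v, hv⟩ := e2
    rw [e1, hh, hh, hh, hv] at e
    have e3 : (h (a + b) : ℤ) = h a + h b - 2 * v := by push_cast at e; linarith
    have e4 := congrArg (Int.cast : ℤ → ZMod 2) e3
    push_cast at e4
    rw [e4]
    linear_combination (-(v : ZMod 2)) * CharTwo.two_eq_zero (R := ZMod 2)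
  have h0 : h 0 = 0 := by have := hhat 0; rw [hat0] at this; omega
  set k : (Fin 6 → ZMod 2) → ℤ := fun a => 4 - (h a : ℤ) with hk
  have hk2 : ∑ a, k a ^ 2 = 64 := by
    simp only [hhat, mul_pow, ← Finset.mul_sum] at hp2
    linarith
  have hk4 : ∑ a, k a ^ 4 = 304 := by
    simp only [hhat, mul_pow, ← Finset.mul_sum] at hp4
    linarith
  have hk0 : k 0 = 4 := by simp [hk, h0]
  have hsmall : ∀ a, a ≠ 0 → k a ^ 2 ≤ 1 := by
    have hnn : ∀ a ∈ Finset.univ, 0 ≤ k a ^ 4 - k a ^ 2 - if a = 0 then 240 else 0 := by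
      intro a _
      split_ifs with ha
      · rw [ha, hk0]; norm_num
      · have h1 : k a ^ 2 = 0 ∨ 1 ≤ k a ^ 2 := by
          have := sq_nonneg (k a)
          omega
        have h2 : k a ^ 4 = (k a ^ 2) ^ 2 := by ring
        rcases h1 with h1 | h1
        · rw [h2, h1]; norm_num
        · nlinarith
    have hs : ∑ a, (k a ^ 4 - k a ^ 2 - if a = 0 then 240 else 0) = 0 := by
      simp only [Finset.sum_sub_distrib, hk2, hk4]
      simp
    intro a ha
    have h1 := (Finset.sum_eq_zero_iff_of_nonneg hnn).1 hs a (Finset.mem_univ _)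
    rw [if_neg ha] at h1
    have h2 : k a ^ 4 = (k a ^ 2) ^ 2 := by ring
    nlinarith
  have hsg : ∀ a, sg (h a : ZMod 2) = 1 - 2 * k a ^ 2 + if a = 0 then 32 else 0 := by
    intro a
    split_ifs with ha
    · rw [ha, hk0, h0]; rfl
    · have h1 := hsmall a ha
      have h2 : -1 ≤ k a ∧ k a ≤ 1 := by constructor <;> nlinarith
      have h3 : h a = 3 ∨ h a = 4 ∨ h a = 5 := by simp only [hk] at h2; omega
      simp only [hk]
      rcases h3 with h3 | h3 | h3 <;> rw [h3] <;> rfl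
  have hsum : ∑ a, sg (h a : ZMod 2) = -32 := by
    simp only [hsg, Finset.sum_add_distrib, Finset.sum_sub_distrib, ← Finset.mul_sum, hk2]
    simp
  by_cases hz : ∃ b, ((h b : ℕ) : ZMod 2) = 1
  · obtain ⟨b, hb⟩ := hz
    have := Equiv.sum_comp (Equiv.addRight b) fun a => sg (h a : ZMod 2)
    simp only [Equiv.coe_addRight, hadd, hb, sg_add, ← Finset.sum_mul, hsum] at this
    norm_num [sg] at this
  · push Not at hz
    have : ∀ a, ((h a : ℕ) : ZMod 2) = 0 := fun a => (zmod_two_eq _).resolve_right (hz a)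
    simp only [this] at hsum
    simp [sg] at hsum

end WeightSixteen

/-! ### Truth tables as natural numbers -/

/-- The position of a point in a truth table. -/
def tableIdx (x : Fin 6 → ZMod 2) : Fin 64 := finFunctionFinEquiv (m := 2) (n := 6) x

/-- The Boolean function with a given truth table. -/
def ofTable (N : ℕ) : BF 6 := fun x => if N.testBit (tableIdx x) then 1 else 0

/-- The number of ones among the first `m` binary digits. -/
def popCount (N : ℕ) : ℕ → ℕ
  | 0 => 0
  | m + 1 => (N >>> m) % 2 + popCount N m

/-- The truth tables of the six coordinates. -/
def coordTable : List ℕ :=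
  [12297829382473034410, 14757395258967641292, 17361641481138401520, 18374966859414961920,
    18446462603027742720, 18446744069414584320]

/-- The sum of the entries of a list of tables selected by the binary digits of a number. -/
def tableSum : List ℕ → ℕ → ℕ
  | [], _ => 0
  | b :: bs, k => (if k % 2 = 1 then b else 0) ^^^ tableSum bs (k / 2)

/-- The table `N` is a sum of entries of a list. -/
def InTableSpan : List ℕ → ℕ → Prop
  | [], N => N = 0
  | b :: bs, N => InTableSpan bs N ∨ InTableSpan bs (N ^^^ b)

/-- Checks a property of `N ^^^ M` for all `M` in the span of a list; the property may use the
position of `M` in the enumeration of the span. -/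
def checkSpan (P : ℕ → ℕ → Bool) : List ℕ → ℕ → ℕ → Bool
  | [], N, k => P N k
  | b :: bs, N, k => checkSpan P bs N (2 * k) && checkSpan P bs (N ^^^ b) (2 * k + 1)

section Table

/-- The truth table position as an equivalence. -/
def tableEquiv : (Fin 6 → ZMod 2) ≃ Fin 64 := finFunctionFinEquiv (m := 2) (n := 6)

lemma forall_of_forall_table {P : (Fin 6 → ZMod 2) → Prop} (h : ∀ k, P (tableEquiv.symm k)) (x) :
    P x := by
  have := h (tableEquiv x)
  rwa [Equiv.symm_apply_apply] at this

lemma ofTable_zero : ofTable 0 = 0 := by funext x; simp [ofTable]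

lemma ofTable_xor (N M : ℕ) : ofTable (N ^^^ M) = ofTable N + ofTable M := by
  funext x
  simp only [ofTable, Nat.testBit_xor, Pi.add_apply]
  cases N.testBit (tableIdx x) <;> cases M.testBit (tableIdx x) <;> decide

lemma ofTable_and (N M : ℕ) : ofTable (N &&& M) = ofTable N * ofTable M := by
  funext x
  simp only [ofTable, Nat.testBit_and, Pi.mul_apply]
  cases N.testBit (tableIdx x) <;> cases M.testBit (tableIdx x) <;> decide

lemma ofTable_coord (i : Fin 6) : ofTable (coordTable.getD i 0) = fun x => x i := by
  funext x
  revert i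
  revert x
  refine forall_of_forall_table ?_
  decide +kernel

lemma ofTable_one : ofTable 18446744073709551615 = 1 := by
  funext x
  revert x
  refine forall_of_forall_table ?_
  decide +kernel

lemma popCount_eq (N m : ℕ) : popCount N m = ∑ k ∈ Finset.range m, (N >>> k) % 2 := by
  induction m with
  | zero => rfl
  | succ m ih => rw [popCount, ih, Finset.sum_range_succ, add_comm]

lemma wt_ofTable (N : ℕ) : wt (ofTable N) = popCount N 64 := by
  rw [wt_eq_sum, popCount_eq, Finset.sum_range, ← tableEquiv.sum_comp]
  refine Finset.sum_congr rfl fun x _ => ?_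
  simp only [ofTable, Nat.testBit_eq_decide_div_mod_eq, Nat.shiftRight_eq_div_pow]
  change ZMod.val (if decide (N / 2 ^ (tableEquiv x).val % 2 = 1) = true then 1 else 0) = _
  rcases Nat.mod_two_eq_zero_or_one (N / 2 ^ (tableEquiv x).val) with h | h <;> rw [h] <;> rfl

lemma InTableSpan.zero (L : List ℕ) : InTableSpan L 0 := by
  induction L with
  | nil => rfl
  | cons b L ih => exact Or.inl ih

lemma InTableSpan.of_mem {L : List ℕ} {b : ℕ} (h : b ∈ L) : InTableSpan L b := by
  induction L with
  | nil => simp at h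
  | cons a L ih =>
    rcases List.mem_cons.1 h with rfl | h
    · right; rw [Nat.xor_self]; exact InTableSpan.zero L
    · exact Or.inl (ih h)

lemma InTableSpan.xor {L : List ℕ} {N M : ℕ} (hN : InTableSpan L N) (hM : InTableSpan L M) :
    InTableSpan L (N ^^^ M) := by
  induction L generalizing N M with
  | nil => simp only [InTableSpan] at *; simp [hN, hM]
  | cons b L ih =>
    rcases hN with hN | hN <;> rcases hM with hM | hM
    · exact Or.inl (ih hN hM)
    · right; rw [Nat.xor_assoc]; exact ih hN hM
    · right
      rw [Nat.xor_right_comm]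
      exact ih hN hM
    · left
      have := ih hN hM
      rwa [Nat.xor_right_comm, Nat.xor_assoc, Nat.xor_assoc, Nat.xor_self, Nat.xor_zero] at this

lemma InTableSpan.degLT {k : ℕ} {L : List ℕ} (hL : ∀ b ∈ L, DegLT k (ofTable b)) {N : ℕ}
    (hN : InTableSpan L N) : DegLT k (ofTable N) := by
  induction L generalizing N with
  | nil => rw [show N = 0 from hN, ofTable_zero]; exact DegLT.zero _
  | cons b L ih =>
    have h := List.forall_mem_cons.1 hL
    rcases hN with hN | hN
    · exact ih h.2 hN
    · have := ih h.2 hN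
      rw [ofTable_xor] at this
      exact this.of_add h.1

lemma inTableSpan_tableSum (L : List ℕ) (k : ℕ) : InTableSpan L (tableSum L k) := by
  induction L generalizing k with
  | nil => rfl
  | cons b L ih =>
    rw [tableSum]
    split_ifs
    · exact (InTableSpan.of_mem List.mem_cons_self).xor (Or.inl (ih _))
    · rw [Nat.zero_xor]; exact Or.inl (ih _)

lemma exists_of_checkSpan {P : ℕ → ℕ → Bool} {L : List ℕ} {N k : ℕ} (h : checkSpan P L N k = true)
    {M : ℕ} (hM : InTableSpan L M) : ∃ j, P (N ^^^ M) j = true := by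
  induction L generalizing N k M with
  | nil => rw [show M = 0 from hM, Nat.xor_zero]; exact ⟨k, h⟩
  | cons b L ih =>
    rw [checkSpan, Bool.and_eq_true] at h
    rcases hM with hM | hM
    · exact ih h.1 hM
    · obtain ⟨j, hj⟩ := ih h.2 hM
      refine ⟨j, ?_⟩
      rwa [Nat.xor_comm M b, Nat.xor_assoc, ← Nat.xor_assoc b b, Nat.xor_self, Nat.zero_xor] at hj

/-- An entry of a list can be removed if it is detected by an additive functional that vanishes on
the other entries. -/
lemma InTableSpan.tail {φ : BF 6 → ZMod 2} (hφ : ∀ f g, φ (f + g) = φ f + φ g) {b : ℕ} {L : List ℕ}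
    (hb : φ (ofTable b) = 1) (hL : ∀ a ∈ L, φ (ofTable a) = 0) {N : ℕ} (hN : InTableSpan (b :: L) N)
    (h : φ (ofTable N) = 0) : InTableSpan L N := by
  have key : ∀ M, InTableSpan L M → φ (ofTable M) = 0 := by
    clear hb hN
    intro M hM
    induction L generalizing M with
    | nil =>
      rw [show M = 0 from hM, ofTable_zero]
      simpa using hφ 0 0
    | cons a L ih =>
      have hL := List.forall_mem_cons.1 hL
      rcases hM with hM | hM
      · exact ih hL.2 _ hM
      · have := ih hL.2 _ hM
        rwa [ofTable_xor, hφ, hL.1, add_zero] at this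
  rcases hN with hN | hN
  · exact hN
  · have := key _ hN
    rw [ofTable_xor, hφ, h, hb] at this
    exact absurd this (by decide)

end Table

/-! ### Cubic forms with many constant second derivatives -/

/-- The truth table of a coordinate. -/
def cTab (i : Fin 6) : ℕ := coordTable.getD i 0

/-- The truth table of a product of three coordinates. -/
def cubicTab (p : Fin 6 × Fin 6 × Fin 6) : ℕ := cTab p.1 &&& (cTab p.2.1 &&& cTab p.2.2)

/-- The truth tables of the monomials of degree at most two. -/
def quadTable : List ℕ :=
  18446744073709551615 :: (coordTable ++
    [(0, 1), (0, 2), (0, 3), (0, 4), (0, 5), (1, 2), (1, 3), (1, 4), (1, 5), (2, 3), (2, 4), (2, 5),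
      (3, 4), (3, 5), (4, 5)].map fun p : Fin 6 × Fin 6 => cTab p.1 &&& cTab p.2)

/-- The cubic monomials that are divisible by `x 5`, except `x 0 * x 1 * x 5`. -/
def mixedMonomials : List (Fin 6 × Fin 6) :=
  [(0, 2), (0, 3), (0, 4), (1, 2), (1, 3), (1, 4), (2, 3), (2, 4), (3, 4)]

/-- The remaining cubic monomials. -/
def pureMonomials : List (Fin 6 × Fin 6 × Fin 6) :=
  [(0, 1, 5), (0, 1, 2), (0, 1, 3), (0, 1, 4), (0, 2, 3), (0, 2, 4), (0, 3, 4), (1, 2, 3),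
    (1, 2, 4), (1, 3, 4), (2, 3, 4)]

/-- The truth table of a sum of coordinates. -/
def linTab (a : ℕ) : ℕ := tableSum coordTable a

/-- The coefficients of six linear forms packed into a certificate. -/
def certForm (c : ℕ) : Fin 6 → ℕ :=
  ![1, 2, ((c >>> 22) % 8) <<< 2, ((c >>> 28) % 8) <<< 2, ((c >>> 25) % 8) <<< 2,
    32 ||| ((c >>> 31) % 8) <<< 2]

/-- The truth table of `fun1` evaluated at six functions. -/
def fun1Tab (B : Fin 6 → ℕ) : ℕ :=
  (B 0 &&& B 1 &&& B 5) ^^^ (B 0 &&& B 2 &&& B 4) ^^^ (B 1 &&& B 2 &&& B 3)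

/-- A certificate shows that adding a quadratic function to a cubic one yields a word of weight less
than sixteen, or that a linear substitution turns it into `fun1`. -/
def cubicCheck (N c : ℕ) : Bool :=
  Nat.ble (popCount (N ^^^ tableSum quadTable (c % 2 ^ 22)) 64) 14 ||
    (Nat.beq (fun1Tab (fun i => linTab (certForm c i)) ^^^ tableSum quadTable (c % 2 ^ 22)) N &&
      Nat.beq (linTab (certForm c 0) ||| linTab (certForm c 1) ||| linTab (certForm c 2) |||
        linTab (certForm c 3) ||| linTab (certForm c 4) ||| linTab (certForm c 5))
        18446744073709551614)

/-- The certificates for the sums of `pureMonomials`, thirty-two per entry. -/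
def certTable : List ℕ :=
  [790633802027703047194589006876626102476923558942611071783748240462533451186185954788908108836438903957475380928138466557564267782786239426723692429427276450073359461123388780029936925622427016578960643908035565877497267316561123712649508682545908065567440885893932840144022248922097584291963420672702531792617605739577344,
    3360193658468169881748254857928730049308189842212704207010279940085063974539280204076816610415797570921602439648667696655218011412587707172652018331853643235068985146926636774570257613328543095604036887513453289068468453835428655613457469551251138111374404406194753181063570236738616091531304957722940542882970083205840896,
    1680096829257095413001788169952219392381838424371847292501139040311239679374243523339337038521062649897578210836582401832882691676594832068829553620234260847032628695015696211371115749218680728592181459955005229949354746846401164116641751254078278054596492553593349130581751421332381594487686615869202791718410391071490048,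
    5881497057271029498526126301988613708939850768899736429258454417495731956073066801345635318900427513198126514981971234628913597051065881553426171879536438968728318366252173687873391823090833902822465027718788020369725876943085625536173029476861663621526225365570635697118284462719736755168295766752645049702482498042200064,
    3953169009961622231491778062990606755261397662505514071022736516133113915164458385062412744999671558166908401765736672145733103659610525524287635133029898032945646775851295632933619878619795319510560167990154069935920673262643095133633557486739532720151582819557711436243557625990550108857165615657532230741780040083570688,
    184532694074735186766720847469110409914585181675028826943527939657325634798405417397910165349738318908475194811470709248251888153582524761664985911669537027203614706035884204681866142947982733615079978330410399676438909343284152017474223628920726653813667287564263025286390807965065789564891684242298071621225532583051264,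
    4842632037185261979267250391941612904914894105309546780201609173967319544667223970342847721716993572771945456870252685501866710594925886268221662915646586373781350151707356830376731726779223366568385664357529344986389508945370698461483067938163442205870873952785549211534532797346829399624955189765771162497430761806757888,
    2527480225389470435258275630006258366722433929059193918900490165968100112284323854261784781037245637485113462527708844301441440248529626759434739781518419637779554470557724590851716832890945024774680895313445334917836655983675143750852980519162924847305784263587314962716332026907135891838360339596207377235225357674610688,
    2371901405996819871105018314022881849784105116436259257702658027369315358107803772998829890069519966645391049329592161849129478468373693640777811767521241879154937719274533009189368217737318410435577054909310956836441155432158684653773406887662788984602943488176312985826099904170292820564947820289237261692853380798480384,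
    4941461262432972242134679760456709246247684870950260795078163650324792006370948719526191363454822318938681778318181573231727927842968550732782638191685876912523234142760568774604484908528707471698711007060586113407271130384822819343971740577106776046793278385949317929294723860271132348466023551695582149486238540121505792,
    98829225299483825154477684615431198295705526122733125543414834716293767732506909630778042512758533507139811848825988341126093459492311302980967213149250539286526027303290910591549886797715834631141039771053476397401429822977639177741478215375508190811516090499339534961869488501583337178543465715218917198373089011826688,
    4204488641305801340258073469652315050907906493594756740248093821134988183097942344025935422660562569284626777827354643115368325438440298880593337033264042495887335339162782194385187093553118502149303375878354271028825604753792632980400858496337397569806226526757899957261830618147067068137927184498225993952932268123095040,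
    5559916023553409121484681394007668633237866554482767787598944293697893636593428858489694542951896105778499837361691102287264008801311014483044876170686344226210491685234209965698154639311716078062700794644293096693263196264361967204420880377849252877675315345063005435379441510411720207044508148368078315779706965494595584,
    1638982327360346838744744998523516539558205537812268159195344618315696111996765993424136453757452430979188031987727876525780665935644613468091790378238571365604052410932995189111932574352668207849156013994371029047385535436059295339270142264794884093945274697537537156354896129101803990068312982451608448918017303923130368,
    3217161518028967480877113469654472009753883622089344085477012484946445220935647884080931375076874862936961806135408895632119821758595172641296448819899730117811344629263464309247324900780278503044833924086858097821649347120835820959195904179917645360577065415407438374960090237781682632697452834530731926301494264601772032,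
    874213986682615304379936036531169630313208625777890293009732009613059738991175923630962788679943979698833518268662742256471718721873080903986103371400056133703980696439711807822668149251891748165409959612541415272394116116603962195996731841785272571203239821866933425110170561213827214351983014390147494948391770845609984,
    46020944255154058755835881186579171834205748531215708621939119694132772206184887287585817823226130961607936166077787128765618722643317069915081331249004797208969573297016917772432741525763528190060549444473686024953319228607880922787147711426730142034439575322031822512135078376442226385192053028182411179982848,
    4150827460449851984687522382829657161643655946685276320872196204172150053055460043334345091250692184498697402912571345438489309381035635427731057236723347898213732922522476721633849064226329711746865098321313964850578313924368575040811087309736904275570096322911744587350359602067540142370711777518102517078515835719385088,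
    2470730631238777515941223118073009613672191887511188182115968918383513401520033945359541661156100127779778860584378845848880155171806681728802250570699996940725630565451058574547954085207506766758507563123996255988852268163435885121105849616141696334252359544158619911662139819895585766452239482335360925095535735799283712,
    5042992849263966792757637543035590375477341246546997419050252481286000422446902425158722928758924034579871578100425896785695718198652396332161726907582513805376695069837854669609429848433876098153177528177981870406370115181531465415490134046980368636486137971118597451160054259628613616622578405442166084876020406969958400,
    3162535207978501974044453262143676943731464563201107158480902964936387562711490218570603507182066700232208821223074139073309665547014388521511823086237851025118301348647775405536828951990547721618465182906664092779941360476454138346029930154407369862502916347057755592994609891287439529219217800152574412576422383620980736,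
    899307344645577185591117237335095348103282896470502981371848826993789528648732923154909060709300356699364640504657677216751524622039340604304325767441329794588466352756994390693338161497288134826919848831303337599912920261625874609305873029774929821847409228546786229718755156081350298211210948713382816156062143018434688,
    5658745248799681229844137198186649975940584406384970263480884360871539521274270892693156636035380530424498972513740350766747123704927854521128930211327027340733759753305961464577754640885383898944859235041716647540034462299693309271815042872201408017410666121463593836134966522401547765560849772024532881326366427275329536,
    1712718194633567513175780047730839433996186853988659721228774874352901339617883784957082821876983771828039154800649622170667107287903358324019156125856577955172001045157216109355815455937857371200737950112656614018540577277937526198381728031793771300360446964883534601975234807876027618175985397228702787597607378133975040,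
    1581267604015137768165583365902130609749797253293239831144991946901788449725075280340745918723031101226776558322153312369191338762783596524542027076410716996899101414063646287057436744373467443314879504756043067784210862458287709223998958008017938154883757449803754851567250886255604031939583735381183102517876971922259968,
    5757574474047391492711566566701751189930380021147324215779234972149050692058910937572152826666668229089089177857946903044656335368422909426331895970975500984683038465537322769714590715209352856207683036756218471450032164898973839496847870951358823763706491286148913581117849658540344576962520795826172322447912251995193344,
    889463027281165928093912632736182438330023349412006318030251248610102539951083885381568763925020858253671978643052721693666937173034042875832333562783515814735920949335641761858703709596509048099450627181196162022206243984004331620548003925956455224231221617451788517842180479315567836462403814230505494607989556350288000,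
    3389726610549898418175577887376900990838664830466140270118889459320918985044235108182733229228670732415634980884777478992527740094172381453987789903528662991515475874559856975255804755859304335691998320080314730657534531104957075355762298065316429336915813316991882398759066175952569955701884755626526804406203627090214912,
    4743802811936113561889168687572435896649655959796070314254057853903133676969604259925894223832835725562967191827461452436439088919550275248472439911738362598317341400143204786988060327958740176665896831879482563720002815847426016248466712486671286233170767497685753571751145011129907133094614587410601575741827739455324160,
    2403557642214729682711970887409603712960390454063949520046113245897625510153305947724755548730235755673180907033605862886779141848251334559548498099743489373888135799118225137797622542954167253989667550186394922584980837119122602046442830851947499694957694225982919794453783667672894282409564992542767367366869441310621696,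
    3981736832883350324844339358540568928470079654714139097569536963763440585465615002573913881182545837386900496501709120110747525837224129886521787370914543938871862737214233818068054794476838519690578388670106030844139036752245579998160489691024531550131760761781525861869999608620532062055783241211326582944634308619403264,
    11967601515041491248212841005447468753496705473214969597992712079643501817771547310863957429213790095860435424595840470470275709377245015899834477165387538083532283898674217972582100824473532307701810639389882408029744330555410475020858108245856265135092801485793928588154326663932374165086226203343050082939550998462592,
    5535218802137456673968429357343730587550519407245816895280117896816643145134700385250074947435534864425041913632178061726341671295301787936985793424615637421588647430674086361876733095955869629644914403014471783311777063153319988828880580757229937278837847412126600340430009770451175289842718080746964583034898294228647936,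
    5732883897269118586811795643200798463193372010306272311479699251727965532387378597000044095829186828621867409367219314338174024853769281022847270540623638563596306399024722789076037167563800502455203605751129110080846033515907133767811192865668041448938018780160876462584046065639997750601206941775321726435841781234925568,
    5634047980207946460017464742736693804293534352913160233413984921838282747977733582747312159375569976569448395896051173893925477534426512437531406750148877448143707761030334273538363902464829899773117042592863189064434958706839217294462796534746450923096334850118411884085864537857655617089115269887798103904073222549667840,
    5881497057294039970653369807929410325370411025526140243738340499262898461673875572848884604982032018520795693180475605304484098453501781890107344655956730264487138827532933661625291360779216215801666337415957960713814417184761921029799368867943598367266306240610988114297816257151380937709606939941315643350331498805854208,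
    5535315315052737641022011158334897425489846154169864107888479949870952883869220869173321088492852518699963503630976128621357612710132049292098970575942807616671743634123171908984813276271382246343996408065042373295251322661355127384528034895248192287006220005600056947030346747525031618966452420108154027655509470234017792,
    5732980410184399553865377444191965301132698757230319524088061304782275271121899080923277518659808486438704669995529321693958964655963457509993018988663981377142781271796783580154370445843221404731531977607506010500504735671170885973973219946356391171574350941893735150737540617919016770753784779030747599881540207346974720,
    5634144493123227427071046543727860642232861098729293645535757116090601990179957661405496222653414817501053461028319269362776405779976627737227007284774026024909348440879124463965036902425238114289027093834345259364702605261414210032378361106645161391105217769165958456806258446825594941714142167798893087920283114203512832,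
    5881497057305545206716488956737354192759954726709314532919424568541668339644979048386988872102592803092452033877825129074417172172572288484994277153103079945897776366553736899413884244997335155805079195808390852791955009472758850153154052812279847983520794879069166481826553898795801315050108217026474334872167272352317440,
    5535267058595097157495220257839314006520182780707840501584298923343798014501960627211698017964193691562502708631577095173849642002716918614542382000279222519130195532398629135430773186113625937994455405539757078303514192907337558106704307826239064782922033708863328643730178258988103454404585250427559305345203882231332864,
    5732932153726759070338586543696381882163035383768295917783880278255120401754638838961660807244497657530286039681374318016066494754866369266420144764643809970369543835410753184615203806703510953593367791679317560290675384593539009870892206406012216310256184861027305806660793341779507260677495860403034663158690994290950144,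
    5634096236665586943544255643232277223263197725821226939474871018964442369078845622076404191014492397035250928462185221628350941657201570087379207017461451736526528100954729368751700402445034007031072068213604224214568781984126713663420578820695806157100776309642185170446061492341625279401628718843345595912178168376590336,
    5881497057299792588684929382333382259065182876117727388328882533902283400659427310617936738542312410806623863529150367189450635313037035187550810904529905105192457597043335280519587802888275685803372766612174406752884713328760385591476710840111723175393550559840077298062185077973591126379857578483894989111249385579085824,
    5535363571510378124548802058830480844459509527631887714192660976398107753236481111134944159021511345837424298630375162068865583417547179969655559151606392714213291735847714682538853366429138554693537410590327668286988452415372696662351761964257319791090406302336785250330515236061959783528319589788748749965815058236702720,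
    5733028666642040037392168344687548720102362130692343130392242331309430140489159322884894230075119315347123300309684325371851434557060545753565893212684152783916018708182813975693537084982931855869696163535694460710334086748802762077054233486700566032892517022760164494814287894058526280830073697658460536604389420402999296,
    5634192749580867910597837444223444061202524471637360351596643213216761611281069700734588254292337237966855993594453317097201869902751685387074807552086600313292168780803519559178373402405442221546982119455086294514836428538701706401336143392594516625109659228689731743166455401309564604026655616754440579928388060030435328,
    5881497057311297824748048531141326126454726577300901677509966603181053278630530786156041005662873195378280204226499890959383709032107541782437743401676254786603095136064138518308180687106394625806785625004607298831025305616757314714831394784447972791648039198298255665590922719618011503720358855569053680633085159125549056,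
    5535242930366276915731824807591522297035351093976828698432208410080220579818330506230886482699864277993772311131877578450095656649009353275764087712447429970359421481536357748653753141034747783819684904277114430807645628030328773467792444291734501030879940560494964492080094014719639372123651665587261944190051088229990400,
    5732908025497938828575191093448590172678203697037284114631789764991542967071008717980852451536842243076076724524296816177120259804317825144633707652633724266982925117217737986845620487133655728024285698715223335185760709054723071819351699635840128879597101820594091134622419703709752505639351401089178194797266387762937856,
    5634072108436766701780860192984485513778366039367193586444427970401362558528289602411858175195031186802349662179118197761138209595814041262455306883805164592335117930992531821145032152454931953402094555403233706639501870345482965478941687677721128540098555579880298527265963015099640448245371994365571849908125695463129088,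
    5881497057291163661637590184226662515607272071674356289700996135549841168569603996107634640941925543389392737202137142602811482295824327266227016448323546567059335040308045898482843886304904279775279677002243685078882845072158332488803081041820495551792621928636305489838093906018807720174700908290850584828242467020079104,
    5535339443281557882785406608582689134974677840900875911040570463134530318552850990154132623757181932268693901130675645345111598063839614630877264863774600165442517684985443295761833321350260400518766909327685020791119887538363912023439898429752756039048313153968421098680430991793495701247386004948451388810662264235360256,
    5733004538413219795628772894439757010617530443961331327240151818045852705805529201904085874367463900892913985152606823532905199606512001631779456100674067080529399989989798777923953765413076630300614070571600235605419411209986824025513726716528478602233433982326949822775914255988771525791929238344604068242964813874987008,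
    5634168621352047668834441993975652351717692785183326998566200164653681800730513681070042238472876027733954727311386293229989137841364156562150907418430313169100758610841322011571705152415340167918004606644715776939769516900057958216857252249619839008107438498927845099986356924067579772870398892276666833924335587116974080,
    5881497057302668897700709333034606382996815772857530578882080204828611046540707471645738908062486327961049077899486666372744556014894833861113948945469896248469972579328849136271436770523023219778692535394676577157023437360155261612157764986156745168047110567094483857366831547663228097515202185376009276350078240566542336,
    5535291186823917399258615708087105716005014467438852304736389436607375449185590748192509553228523105131233106131276611897603627356424483953320676288111015067900969583260900522207793231192504092169225906802399725799382757784346342745616171360743628534964126857231692795380262503256567536685518835267856666500356676232675328,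
    5732956281955579312101981993944173591647867070499307720935970791518697836438268959942469162952153071984495354838451819855012729705414913388206581876653895673756162553603768382384787126273366179162449884643411785395590060132354947922432713176184303740915267901460520478699166979849262015715640319716891131520115600818962432,
    5634120364894407185307651093480068932748029412275260292505314067527522179629401641740950206833953607268152194745252245495563673718589098912303107151117738880717938270916926916358368652435136060660049581023974741789635693622770461847899469963670483774102997039404071813626159969583610110557885443321119341916230641290051584,
    5881497057296916279669149758630634449302043922265943434291538170189226107555155733876686774502205935675220907550811904487778019155359580563670482696896721407764653809818447517377140328413963749776986106198460131117953141216156797050480423013988620359919866247865394673602462726841017908844951546833429930589160353793310720,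
    5535387699739198366312197509078272553944341214362899517344751489661685187920111232115755694285840759406154696130074678792619568771254745308433853439438185262984065786709986069315873411508016708868307911852970315782857017292381481301263625498761883543132499450705149401980599480330423865809253174629046111120967852238045184,
    5733052794870860279155563794935340429587193817423354933544332844573007575172789443865702585782774729801332615466761827210797669507609089875352330324694238487302637426375829173463120404552787081438778256499788685815248762287618700128594740256872653463551600063193379166852661532128281035868218156972317004965814026931011584,
    5634216877809688152361232894471235770687356158091393704627086261779841421831625720399134270111798448199757259877520340964414601964139214211998707685742887457483578950765717106785041652395544275175959632265456812089903340177345454585815034535569194242111879958451618386346553878551549435182912341232214325932440532943896576,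
    5881497057308421515732268907438578316691587623449117723472622239467995985526259209414791041622766720246877248248161428257711092874430087158557415194043071089175291348839250755165733212632082689780398964590893023196093733504153726173835106958324869976174354886323573041131200368485438286185452823918588622110996127339773952]

section Cubic

variable {n : ℕ}

lemma checkSpan_pureMonomials :
    checkSpan (fun N k => cubicCheck N ((certTable.getD (k / 32) 0 >>> (34 * (k % 32))) % 2 ^ 34))
      (pureMonomials.map cubicTab) 0 0 = true := by
  decide +kernel

lemma ofTable_cTab (i : Fin 6) : ofTable (cTab i) = fun x => x i := ofTable_coord i

lemma ofTable_cubicTab (p : Fin 6 × Fin 6 × Fin 6) :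
    ofTable (cubicTab p) = fun x => x p.1 * (x p.2.1 * x p.2.2) := by
  simp only [cubicTab, ofTable_and, ofTable_cTab]; rfl

lemma degLT_quadTable : ∀ b ∈ quadTable, DegLT 3 (ofTable b) := by
  intro b hb
  have hc : ∀ i, DegLT 2 (ofTable (cTab i)) := fun i => by
    rw [ofTable_cTab]; exact degLT_coord i
  rcases List.mem_cons.1 hb with rfl | hb
  · rw [ofTable_one]; exact (degLT_const 1).mono (by norm_num)
  rcases List.mem_append.1 hb with hb | hb
  · obtain ⟨i, hi, rfl⟩ := List.getElem_of_mem hb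
    have := (hc ⟨i, hi⟩).succ
    rwa [cTab, List.getD_eq_getElem _ _ hi] at this
  · obtain ⟨p, -, rfl⟩ := List.mem_map.1 hb
    rw [ofTable_and]
    exact (hc _).mul (hc _)

/-- A sum of coordinates is additive. -/
lemma ofTable_linTab_add (a : ℕ) (x y : Fin 6 → ZMod 2) :
    ofTable (linTab a) (x + y) = ofTable (linTab a) x + ofTable (linTab a) y := by
  have : ∀ N, InTableSpan coordTable N → ∀ x y, ofTable N (x + y) = ofTable N x + ofTable N y := by
    have hmem : ∀ b ∈ coordTable, ∀ x y, ofTable b (x + y) = ofTable b x + ofTable b y := by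
      intro b hb x y
      obtain ⟨i, hi, rfl⟩ := List.getElem_of_mem hb
      have := ofTable_coord ⟨i, hi⟩
      rw [List.getD_eq_getElem _ _ hi] at this
      rw [this]; rfl
    clear x y
    generalize coordTable = L at hmem
    induction L with
    | nil => intro N hN x y; rw [show N = 0 from hN, ofTable_zero]; simp
    | cons b L ih =>
      have h := List.forall_mem_cons.1 hmem
      rintro N (hN | hN) x y
      · exact ih h.2 N hN x y
      · have h1 := ih h.2 _ hN x y
        simp only [ofTable_xor, Pi.add_apply, h.1 x y] at h1
        linear_combination h1
  exact this _ (inTableSpan_tableSum _ _) x y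

lemma isAff_of_add {m : ℕ} {σ : (Fin n → ZMod 2) → (Fin m → ZMod 2)}
    (h : ∀ x y, σ (x + y) = σ x + σ y) : IsAff σ := by
  have h0 : σ 0 = 0 := by simpa using h 0 0
  intro x t
  rw [h, h0, add_zero]

lemma fun1_comp_ofTable (B : Fin 6 → ℕ) :
    (fun1 ∘ fun x i => ofTable (B i) x) = ofTable (fun1Tab B) := by
  funext x
  simp only [fun1Tab, ofTable_xor, ofTable_and, fun1, Function.comp_apply, Pi.add_apply,
    Pi.mul_apply]

lemma exists_equiv_of_cubicCheck {N k : ℕ} (h : cubicCheck N k = true) {C : BF 6}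
    (hC : DegLT 3 (C + ofTable N)) (h16 : ∀ q, DegLT 3 q → 16 ≤ wt (C + q)) :
    ∃ τ : (Fin 6 → ZMod 2) ≃ (Fin 6 → ZMod 2), IsAff τ ∧ DegLT 3 (C + fun1 ∘ τ) := by
  have hq : DegLT 3 (ofTable (tableSum quadTable (k % 2 ^ 22))) :=
    (inTableSpan_tableSum _ _).degLT degLT_quadTable
  rw [cubicCheck, Bool.or_eq_true, Bool.and_eq_true] at h
  rcases h with h | ⟨h1, h2⟩
  · exfalso
    have h1 := Nat.le_of_ble_eq_true h
    have h2 := h16 _ (hC.add hq)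
    rw [add_assoc, ← add_assoc C, bf_add_self, zero_add, ← ofTable_xor, wt_ofTable] at h2
    omega
  · have h1 := Nat.eq_of_beq_eq_true h1
    have h2 := Nat.eq_of_beq_eq_true h2
    set τ : (Fin 6 → ZMod 2) → (Fin 6 → ZMod 2) :=
      fun x i => ofTable (linTab (certForm k i)) x with hτ
    have hadd : ∀ x y, τ (x + y) = τ x + τ y := fun x y =>
      funext fun i => ofTable_linTab_add _ x y
    have hker : ∀ x, τ x = 0 → x = 0 := by
      intro x hx
      have hx' : ∀ i, (linTab (certForm k i)).testBit (tableIdx x) = false := by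
        intro i
        have := congrFun hx i
        simp only [hτ, ofTable, Pi.zero_apply] at this
        by_contra hne
        rw [Bool.not_eq_false] at hne
        rw [hne] at this
        exact absurd this (by decide)
      have := congrArg (fun M => M.testBit (tableIdx x)) h2
      simp only [Nat.testBit_or, hx', Bool.or_false] at this
      revert this
      clear * -
      revert x
      refine forall_of_forall_table ?_
      decide +kernel
    have hinj : Function.Injective τ := by
      intro x y hxy
      have := hker (x + y) (by rw [hadd, hxy, vec_add_self])
      have := congrArg (· + y) this
      simpa only [add_assoc, vec_add_self, add_zero, zero_add] using this
    refine ⟨Equiv.ofBijective τ (Finite.injective_iff_bijective.1 hinj), isAff_of_add hadd, ?_⟩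
    change DegLT 3 (C + fun1 ∘ τ)
    have e : fun1 ∘ τ = ofTable N + ofTable (tableSum quadTable (k % 2 ^ 22)) := by
      rw [fun1_comp_ofTable, ← h1, ofTable_xor, add_assoc, bf_add_self, add_zero]
    rw [e, ← add_assoc]
    exact hC.add hq

lemma exists_table_of_cubic {C : BF 6} (hC : DegLT 4 C) :
    ∃ M, InTableSpan (mixedMonomials.map (fun p => cubicTab (p.1, p.2, 5))
      ++ pureMonomials.map cubicTab) M ∧ DegLT 3 (C + ofTable M) := by
  set L := mixedMonomials.map (fun p => cubicTab (p.1, p.2, 5)) ++ pureMonomials.map cubicTab with hL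
  refine DegLT.induction (k := 3) (P := fun C => ∃ M, InTableSpan L M ∧ DegLT 3 (C + ofTable M))
    ⟨0, InTableSpan.zero _, ?_⟩ ?_ ?_ hC
  · rw [ofTable_zero, add_zero]; exact DegLT.zero _
  · rintro f g ⟨M, hM, h⟩ ⟨M', hM', h'⟩
    refine ⟨M ^^^ M', hM.xor hM', ?_⟩
    rw [ofTable_xor, add_add_add_comm]
    exact h.add h'
  · intro s hs
    have hlow : ∀ f : BF 6, DegLT 3 f → ∃ M, InTableSpan L M ∧ DegLT 3 (f + ofTable M) :=
      fun f hf => ⟨0, InTableSpan.zero _, by rwa [ofTable_zero, add_zero]⟩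
    rcases hs.lt_or_eq with hs | hs
    · exact hlow _ ((degLT_monomial s).mono (by omega))
    · obtain ⟨i, j, k, rfl⟩ := Multiset.card_eq_three.1 hs
      have hd : (i = j ∨ i = k ∨ j = k) ∨ cubicTab (i, j, k) ∈ L := by
        revert i j k
        decide +kernel
      have e : (fun x : Fin 6 → ZMod 2 => (({i, j, k} : Multiset (Fin 6)).map x).prod)
          = fun x => x i * (x j * x k) := by
        funext x; simp
      rw [e]
      have hsq : ∀ a : ZMod 2, a * a = a := by decide
      have h2 : ∀ i j : Fin 6, DegLT 3 (fun x : Fin 6 → ZMod 2 => x i * x j) := fun i j =>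
        (degLT_coord i).mul (degLT_coord j)
      rcases hd with (rfl | rfl | rfl) | hd
      · refine hlow _ ?_
        simp only [← mul_assoc, hsq]
        exact h2 _ _
      · refine hlow _ ?_
        have e' : (fun x : Fin 6 → ZMod 2 => x i * (x j * x i)) = fun x => x j * x i := by
          funext x; rw [mul_left_comm, hsq]
        rw [e']
        exact h2 _ _
      · refine hlow _ ?_
        simp only [hsq]
        exact h2 _ _
      · refine ⟨_, InTableSpan.of_mem hd, ?_⟩
        rw [ofTable_cubicTab, bf_add_self]
        exact DegLT.zero _

/-- The coefficient of `x i * x j * x 5`, expressed as a third derivative. -/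
def mixedCoeff (p : Fin 6 × Fin 6) (f : BF 6) : ZMod 2 :=
  bder (Pi.single p.1 1) (bder (Pi.single p.2 1) (bder (Pi.single 5 1) f)) 0

lemma mixedCoeff_add (p : Fin 6 × Fin 6) (f g : BF 6) :
    mixedCoeff p (f + g) = mixedCoeff p f + mixedCoeff p g := by
  simp only [mixedCoeff, bder_add, Pi.add_apply]

lemma InTableSpan.of_mixedCoeff {l : List (Fin 6 × Fin 6)} {L : List ℕ} (hnd : l.Nodup)
    (h₁ : ∀ p ∈ l, ∀ q ∈ l,
      mixedCoeff p (ofTable (cubicTab (q.1, q.2, 5))) = if p = q then 1 else 0)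
    (h₂ : ∀ p ∈ l, ∀ a ∈ L, mixedCoeff p (ofTable a) = 0) {M : ℕ}
    (hM : InTableSpan (l.map (fun p => cubicTab (p.1, p.2, 5)) ++ L) M)
    (h : ∀ p ∈ l, mixedCoeff p (ofTable M) = 0) : InTableSpan L M := by
  induction l with
  | nil => exact hM
  | cons p l ih =>
    have hp : p ∈ p :: l := List.mem_cons_self
    rw [List.nodup_cons] at hnd
    refine ih hnd.2 (fun q hq r hr => h₁ q (List.mem_cons_of_mem _ hq) r (List.mem_cons_of_mem _ hr))
      (fun q hq => h₂ q (List.mem_cons_of_mem _ hq)) ?_ (fun q hq => h q (List.mem_cons_of_mem _ hq))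
    refine InTableSpan.tail (mixedCoeff_add p) ?_ (fun a ha => ?_) hM (h p hp)
    · rw [h₁ p hp p hp, if_pos rfl]
    · rcases List.mem_append.1 ha with ha | ha
      · obtain ⟨q, hq, rfl⟩ := List.mem_map.1 ha
        rw [h₁ p hp q (List.mem_cons_of_mem _ hq), if_neg]
        rintro rfl
        exact hnd.1 hq
      · exact h₂ p hp a ha

lemma exists_equiv_of_derivatives {C : BF 6} (hC : DegLT 4 C)
    (h16 : ∀ q, DegLT 3 q → 16 ≤ wt (C + q))
    (hD : ∀ j ∈ ({2, 3, 4} : Finset (Fin 6)),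
      DegLT 1 (bder (Pi.single j 1) (bder (Pi.single 5 1) C))) :
    ∃ τ : (Fin 6 → ZMod 2) ≃ (Fin 6 → ZMod 2), IsAff τ ∧ DegLT 3 (C + fun1 ∘ τ) := by
  obtain ⟨M, hM, hCM⟩ := exists_table_of_cubic hC
  have hM' : InTableSpan (pureMonomials.map cubicTab) M := by
    refine hM.of_mixedCoeff (by decide) (by decide +kernel) (by decide +kernel) fun p hp => ?_
    have h1 : mixedCoeff p (C + ofTable M) = 0 := by
      have : bder (Pi.single p.1 1) (bder (Pi.single p.2 1) (bder (Pi.single 5 1) (C + ofTable M)))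
        = 0 := hCM _ _ _
      rw [mixedCoeff, this]; rfl
    have h2 : mixedCoeff p C = 0 := by
      have h3 : p.2 ∈ ({2, 3, 4} : Finset (Fin 6)) := by
        clear h1
        revert p
        decide
      have : bder (Pi.single p.1 1) (bder (Pi.single p.2 1) (bder (Pi.single 5 1) C)) = 0 :=
        hD _ h3 _
      rw [mixedCoeff, this]; rfl
    rwa [mixedCoeff_add, h2, zero_add] at h1
  obtain ⟨k, hk⟩ := exists_of_checkSpan checkSpan_pureMonomials hM'
  rw [Nat.zero_xor] at hk
  exact exists_equiv_of_cubicCheck hk hCM h16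

end Cubic

/-! ### Classification of the relevant affine class -/

section Classification

variable {n : ℕ}

lemma exists_linearIndependent_cons {k : ℕ} {v : Fin k → (Fin n → ZMod 2)}
    (hv : LinearIndependent (ZMod 2) v) (R : Finset (Fin n → ZMod 2)) (hR : 2 ^ k < R.card) :
    ∃ r ∈ R, LinearIndependent (ZMod 2) (Fin.cons r v : Fin (k + 1) → (Fin n → ZMod 2)) := by
  by_contra hcon
  push Not at hcon
  have hsub : ∀ r ∈ R, r ∈ Submodule.span (ZMod 2) (Set.range v) := by
    intro r hr
    by_contra h
    exact hcon r hr (linearIndependent_finCons.2 ⟨hv, h⟩)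
  have hcard : Nat.card (Submodule.span (ZMod 2) (Set.range v)) = 2 ^ k := by
    rw [Module.natCard_eq_pow_finrank (K := ZMod 2), finrank_span_eq_card hv]
    simp
  have : R.card ≤ 2 ^ k := by
    rw [← hcard, ← Set.ncard_coe_finset]
    exact (Set.ncard_le_ncard (t := (Submodule.span (ZMod 2) (Set.range v) : Set _))
      (fun r hr => hsub r hr) (Set.toFinite _)).trans_eq (Nat.card_coe_set_eq _).symm
  omega

lemma IsAff.comp {m k : ℕ} {σ : (Fin n → ZMod 2) → (Fin m → ZMod 2)}
    {τ : (Fin m → ZMod 2) → (Fin k → ZMod 2)} (hτ : IsAff τ) (hσ : IsAff σ) : IsAff (τ ∘ σ) := by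
  intro x t
  have h := hτ (σ x) (σ t + σ 0)
  have h2 := hτ (σ t) (σ 0)
  simp only [Function.comp_apply]
  rw [hσ, h, h2]
  have h3 := vec_add_self (τ 0)
  calc τ (σ x) + (τ (σ t) + (τ (σ 0) + τ 0) + τ 0)
      = τ (σ x) + (τ (σ t) + τ (σ 0)) + (τ 0 + τ 0) := by abel
    _ = τ (σ x) + (τ (σ t) + τ (σ 0)) := by rw [h3, add_zero]

lemma IsAff.symm {m : ℕ} {σ : (Fin n → ZMod 2) ≃ (Fin m → ZMod 2)} (hσ : IsAff σ) :
    IsAff σ.symm := by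
  intro x t
  apply σ.injective
  rw [hσ, hσ (σ.symm t)]
  simp only [Equiv.apply_symm_apply]
  rw [zero_add, add_assoc t, vec_add_self, add_zero]

/-- The property of being affinely equivalent to `fun1` plus a point, up to quadratic functions. -/
def IsSpecial (f : BF 6) : Prop :=
  ∃ σ : (Fin 6 → ZMod 2) ≃ (Fin 6 → ZMod 2), IsAff σ ∧ DegLT 3 (f ∘ σ + fun1 + pointInd 0)

lemma degLT_fun1 : DegLT 4 fun1 :=
  have h : ∀ i j k : Fin 6, DegLT 4 (fun x : Fin 6 → ZMod 2 => x i * x j * x k) := fun i j k =>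
    ((degLT_coord i).mul (degLT_coord j)).mul (degLT_coord k)
  ((h 0 1 5).add (h 0 2 4)).add (h 1 2 3)

lemma exists_equiv_fun1 {c : BF 6} (hc : DegLT 4 c) (h16 : ∀ q, DegLT 3 q → 16 ≤ wt (c + q))
    (hex : ∃ q, DegLT 3 q ∧ wt (c + q) = 16) :
    ∃ σ : (Fin 6 → ZMod 2) ≃ (Fin 6 → ZMod 2), IsAff σ ∧ DegLT 3 (c ∘ σ + fun1) := by
  obtain ⟨q, hq, hwt⟩ := hex
  obtain ⟨t, ht, R, hR, hD⟩ := exists_many_constant_derivatives (hc.add hq.succ) hwt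
  have hD : ∀ r ∈ R, DegLT 1 (bder r (bder t c)) := fun r hr => by
    have := hD r hr
    rw [bder_add, bder_add] at this
    exact this.of_add ((hq.bder t).bder r)
  have huniv : (Finset.univ : Finset (Fin 6 → ZMod 2)).card = 64 := by simp
  obtain ⟨v₅, h₅, i₅⟩ := exists_linearIndependent_cons
    (linearIndependent_empty_type (R := ZMod 2) (v := (![] : Fin 0 → (Fin 6 → ZMod 2)))) {t, 0}
    (by rw [Finset.card_pair ht]; norm_num)
  obtain rfl : v₅ = t := by
    rcases Finset.mem_insert.1 h₅ with h | h
    · exact h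
    · exact absurd (Finset.mem_singleton.1 h) (i₅.ne_zero 0)
  obtain ⟨v₄, h₄, i₄⟩ := exists_linearIndependent_cons i₅ R (by omega)
  obtain ⟨v₃, h₃, i₃⟩ := exists_linearIndependent_cons i₄ R (by omega)
  obtain ⟨v₂, h₂, i₂⟩ := exists_linearIndependent_cons i₃ R (by omega)
  obtain ⟨v₁, -, i₁⟩ := exists_linearIndependent_cons i₂ Finset.univ (by rw [huniv]; norm_num)
  obtain ⟨v₀, -, i₀⟩ := exists_linearIndependent_cons i₁ Finset.univ (by rw [huniv]; norm_num)
  set b := basisOfLinearIndependentOfCardEqFinrank i₀ (by simp) with hb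
  set A := b.equivFun.symm with hA
  have hAadd : IsAff A := isAff_of_add fun x y => map_add A x y
  have hAs : ∀ i, A (Pi.single i 1) = b i := fun i => by
    rw [hA, LinearEquiv.symm_apply_eq]
    funext j
    rw [Module.Basis.equivFun_apply, Module.Basis.repr_self, Finsupp.single_apply, Pi.single_apply]
    simp only [eq_comm]
  have hder : ∀ j, bder (Pi.single j 1) (bder (Pi.single 5 1) (c ∘ A))
      = bder (b j) (bder v₅ c) ∘ A := by
    intro j
    rw [bder_comp hAadd, bder_comp hAadd, map_zero, add_zero, add_zero, hAs, hAs]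
    have : b 5 = v₅ := by rw [hb, coe_basisOfLinearIndependentOfCardEqFinrank]; rfl
    rw [this]
  have hbj : ∀ j ∈ ({2, 3, 4} : Finset (Fin 6)), b j ∈ R := by
    intro j hj
    rw [hb, coe_basisOfLinearIndependentOfCardEqFinrank]
    simp only [Finset.mem_insert, Finset.mem_singleton] at hj
    rcases hj with rfl | rfl | rfl
    exacts [h₂, h₃, h₄]
  obtain ⟨τ, hτ, h⟩ := exists_equiv_of_derivatives (C := c ∘ A) (hc.comp hAadd) (fun q hq => by
      have h1 := h16 (q ∘ A.symm) (hq.comp (isAff_of_add fun x y => map_add A.symm x y))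
      have h2 := wt_comp_equiv (c + q ∘ A.symm) A.toEquiv
      rw [← h2] at h1
      convert h1 using 2
      funext x
      simp)
    (fun j hj => by rw [hder]; exact (hD _ (hbj j hj)).comp hAadd)
  refine ⟨τ.symm.trans A.toEquiv, (IsAff.comp hAadd hτ.symm : IsAff (A ∘ τ.symm)), ?_⟩
  have := h.comp hτ.symm
  convert this using 1
  funext x
  simp

lemma isSpecial_of_isBent {f : BF 6} (h15 : ∀ q, DegLT 3 q → 15 ≤ wt (f + q))
    (hex : ∃ q, DegLT 3 q ∧ wt (f + q) = 15)
    (hB : ∃ q, DegLT 3 q ∧ ∀ l, DegLT 2 l → 26 ≤ wt (f + q + l)) : IsSpecial f := by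
  have hsum : ∑ x, f x = 1 := by
    obtain ⟨q, hq, h⟩ := hex
    have h1 := wt_cast (f + q)
    have h2 := sum_eq_zero_of_degLT (hq.mono (show 3 ≤ 6 by norm_num))
    simp only [Pi.add_apply, Finset.sum_add_distrib, h2, add_zero, h] at h1
    rw [← h1]; decide
  obtain ⟨q, hq, h⟩ := hB
  have hfq : ∑ x, (f + q) x = 1 := by
    simp only [Pi.add_apply, Finset.sum_add_distrib, hsum,
      sum_eq_zero_of_degLT (hq.mono (show 3 ≤ 6 by norm_num)), add_zero]
  obtain ⟨p, hp⟩ := exists_pointInd_add_degLT hfq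
  have hbent : IsBent (f + q + pointInd p) := by
    refine isBent_of_pointInd hp (p := p) fun l hl => ?_
    rw [add_assoc (f + q), bf_add_self, add_zero]
    exact h l hl
  set c := f + pointInd p with hc_def
  have hfc : c + pointInd p = f := by rw [hc_def, add_assoc, bf_add_self, add_zero]
  have hc : DegLT 4 c := by
    have := hbent.degLT
    rw [add_right_comm] at this
    exact this.of_add hq.succ
  rw [← hfc] at h15 hex
  obtain ⟨h16, hex16⟩ := exists_wt_eq_sixteen hc h15 hex
  obtain ⟨σ, hσ, hdeg⟩ := exists_equiv_fun1 hc h16 hex16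
  refine ⟨(Equiv.addRight (σ.symm p)).trans σ,
    (IsAff.comp hσ (isAff_translate _) : IsAff (σ ∘ fun x => x + σ.symm p)), ?_⟩
  have e : f ∘ ((Equiv.addRight (σ.symm p)).trans σ) + fun1 + pointInd 0
      = (fun x => (c ∘ σ + fun1) (x + σ.symm p)) + bder (σ.symm p) fun1 := by
    funext x
    have hpt : pointInd p (σ (x + σ.symm p)) = pointInd 0 x := by
      have : σ (x + σ.symm p) = p ↔ x = 0 := by
        rw [← Equiv.eq_symm_apply, add_eq_right]
      simp only [pointInd, this]
    simp only [← hfc, Pi.add_apply, Function.comp_apply, Equiv.trans_apply, Equiv.coe_addRight, hpt,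
      bder]
    linear_combination (pointInd 0 x - fun1 (x + σ.symm p)) * CharTwo.two_eq_zero (R := ZMod 2)
  rw [e]
  exact (hdeg.translate _).add (degLT_fun1.bder _)

end Classification

/-! ### Words of minimal weight and bent functions in the relevant class -/

/-- Quadratic functions, as sums of `quadTable`, that together with `fun1` have weight sixteen and
do not vanish at the origin. -/
def minCodes : List ℕ :=
  [78367, 78495, 78623, 78751, 78877, 79005, 79135, 79263, 79901, 80031, 80157, 80287, 80925,
    81055, 81183, 81309, 100551, 100807, 104655, 104911, 109783, 110037, 113757, 114015,
    117991, 118119, 122095, 122223, 125175, 125301, 129149, 129535, 140587, 140715, 144687,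
    144815, 148783, 148911, 152879, 153007, 165163, 165295, 166087, 166351, 167671, 167803,
    169259, 169391, 170183, 170447, 171635, 172031, 173355, 173487, 174807, 175071, 175335,
    175467, 177455, 177579, 178775, 179039, 179427, 179567, 208187]

/-- The truth tables corresponding to `minCodes`. -/
def minWord (i : Fin 65) : ℕ := fun1Tab cTab ^^^ tableSum quadTable (minCodes.getD i 0)

/-- The truth tables of quadratic monomials that complement the derivatives of `fun1` modulo affine
functions. -/
def complTable : List ℕ :=
  [(3, 4), (3, 5), (4, 5), (0, 3), (1, 4), (2, 5), (2, 4), (2, 3), (1, 3)].map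
    fun p : Fin 6 × Fin 6 => cTab p.1 &&& cTab p.2

/-- The truth table of a bent function. -/
def bentWord : ℕ := 12890479129771398656

/-- Checks that a table is `bentWord` or is not the table of a bent function. -/
def bentCheck (N : ℕ) (_ : ℕ) : Bool :=
  Nat.beq N bentWord || [0, 1, 2, 4, 8, 16, 32].any fun a =>
    !(Nat.beq (popCount (N ^^^ linTab a) 64) 28) && !(Nat.beq (popCount (N ^^^ linTab a) 64) 36)

section Counting

lemma ofTable_fun1Tab_cTab : ofTable (fun1Tab cTab) = fun1 := by
  rw [← fun1_comp_ofTable]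
  funext x
  exact congrArg fun1 (funext fun i => congrFun (ofTable_coord i) x)

lemma ofTable_injOn {N M : ℕ} (hN : N < 2 ^ 64) (hM : M < 2 ^ 64) (h : ofTable N = ofTable M) :
    N = M := by
  refine Nat.eq_of_testBit_eq fun i => ?_
  rcases lt_or_ge i 64 with hi | hi
  · have h1 := congrFun h (tableEquiv.symm ⟨i, hi⟩)
    have h2 : tableIdx (tableEquiv.symm ⟨i, hi⟩) = ⟨i, hi⟩ := tableEquiv.apply_symm_apply _
    simp only [ofTable, h2] at h1
    cases hb : N.testBit i <;> cases hc : M.testBit i <;> simp_all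
  · rw [Nat.testBit_lt_two_pow (hN.trans_le (Nat.pow_le_pow_right two_pos hi)),
      Nat.testBit_lt_two_pow (hM.trans_le (Nat.pow_le_pow_right two_pos hi))]

lemma minWord_spec : ∀ i, popCount (minWord i) 64 = 16 ∧ (minWord i).testBit 0 = true ∧
    minWord i < 2 ^ 64 := by
  decide +kernel

lemma minWord_injective : Function.Injective minWord := by
  unfold Function.Injective
  decide +kernel

lemma checkSpan_complTable : checkSpan bentCheck complTable (fun1Tab cTab) 0 = true := by
  decide +kernel

lemma degLT_linTab (a : ℕ) : DegLT 2 (ofTable (linTab a)) := by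
  refine (inTableSpan_tableSum _ _).degLT fun b hb => ?_
  obtain ⟨i, hi, rfl⟩ := List.getElem_of_mem hb
  have := ofTable_coord ⟨i, hi⟩
  rw [List.getD_eq_getElem _ _ hi] at this
  rw [this]
  exact degLT_coord _

lemma eq_zero_of_wt_lt {l : BF 6} (hl : DegLT 2 l) (h : wt l < 32) : l = 0 := by
  have h1 := dvd_signSum_of_affine hl
  rw [signSum_eq] at h1
  have h2 : wt l = 0 := by omega
  funext x
  by_contra hx
  have := Finset.card_eq_zero.1 h2
  exact absurd (this ▸ Finset.mem_filter.2 ⟨Finset.mem_univ x, hx⟩) (Finset.notMem_empty x)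

lemma IsSpecial.exists_many {f : BF 6} (hf : IsSpecial f) :
    ∃ φ : Fin 65 → BF 6, (∀ i, DegLT 3 (φ i)) ∧ (∀ i, wt (f + φ i) = 15) ∧
      ∀ i j, DegLT 2 (φ i + φ j) → i = j := by
  obtain ⟨σ, hσ, hr⟩ := hf
  set r := f ∘ σ + fun1 + pointInd 0 with hr_def
  have hpt : ∀ i, ofTable (minWord i) 0 = 1 := fun i => by
    have h0 : ((tableIdx 0 : Fin 64) : ℕ) = 0 := by decide
    rw [ofTable, h0, (minWord_spec i).2.1, if_pos rfl]
  have hw : ∀ i, DegLT 3 (ofTable (minWord i) + fun1) := fun i => by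
    rw [minWord, ofTable_xor, ofTable_fun1Tab_cTab, add_right_comm, bf_add_self, zero_add]
    exact (inTableSpan_tableSum _ _).degLT degLT_quadTable
  refine ⟨fun i => (r + (ofTable (minWord i) + fun1)) ∘ σ.symm,
    fun i => (hr.add (hw i)).comp hσ.symm, fun i => ?_, fun i j hij => ?_⟩
  · rw [← wt_comp_equiv _ σ]
    have e : (f + (r + (ofTable (minWord i) + fun1)) ∘ σ.symm) ∘ σ
        = ofTable (minWord i) + pointInd 0 := by
      funext x
      simp only [hr_def, Function.comp_apply, Pi.add_apply, Equiv.symm_apply_apply]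
      linear_combination (f (σ x) + fun1 x) * CharTwo.two_eq_zero (R := ZMod 2)
    have h1 := wt_add_pointInd (ofTable (minWord i)) 0
    rw [hpt, wt_ofTable, (minWord_spec i).1, show sg 1 = -1 from rfl] at h1
    rw [e]
    omega
  · have hdeg : DegLT 2 (ofTable (minWord i) + ofTable (minWord j)) := by
      convert hij.comp hσ using 1
      funext x
      simp only [Function.comp_apply, Pi.add_apply, Equiv.symm_apply_apply]
      linear_combination (-r x - fun1 x) * CharTwo.two_eq_zero (R := ZMod 2)
    have hzero := eq_zero_of_wt_lt hdeg (by
      have h1 := wt_add (ofTable (minWord i)) (ofTable (minWord j))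
      rw [wt_ofTable, wt_ofTable, (minWord_spec i).1, (minWord_spec j).1] at h1
      have h2 : 0 < wt (ofTable (minWord i) * ofTable (minWord j)) :=
        Finset.card_pos.2 ⟨0, by simp [hpt]⟩
      omega)
    have heq : ofTable (minWord i) = ofTable (minWord j) := by
      have := congrArg (· + ofTable (minWord j)) hzero
      simpa only [add_assoc, bf_add_self, add_zero, zero_add] using this
    exact minWord_injective (ofTable_injOn (minWord_spec i).2.2 (minWord_spec j).2.2 heq)

lemma mul_coord_eq_bder_add : ∀ i j : Fin 6, i = j ∨
    ∃ t ∈ (0 : Fin 6 → ZMod 2) :: List.ofFn (fun k => Pi.single k 1), ∃ N ∈ 0 :: complTable,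
      ∀ x : Fin 64, tableEquiv.symm x i * tableEquiv.symm x j
        = bder t fun1 (tableEquiv.symm x) + ofTable N (tableEquiv.symm x) := by
  decide +kernel

lemma exists_bder_add_table {r : BF 6} (hr : DegLT 3 r) :
    ∃ t N, InTableSpan complTable N ∧ DegLT 2 (r + bder t fun1 + ofTable N) := by
  refine DegLT.induction (k := 2)
    (P := fun r => ∃ t N, InTableSpan complTable N ∧ DegLT 2 (r + bder t fun1 + ofTable N))
    ?_ ?_ ?_ hr
  · refine ⟨0, 0, InTableSpan.zero _, ?_⟩
    rw [ofTable_zero, add_zero, zero_add]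
    have : bder (0 : Fin 6 → ZMod 2) fun1 = 0 := by
      funext x; simp only [bder, add_zero]; exact CharTwo.add_self_eq_zero _
    rw [this]
    exact DegLT.zero _
  · rintro f g ⟨t, N, hN, h⟩ ⟨t', N', hN', h'⟩
    refine ⟨t + t', N ^^^ N', hN.xor hN', ?_⟩
    convert (h.add h').add ((degLT_fun1.bder t).bder t') using 1
    funext x
    simp only [Pi.add_apply, ofTable_xor, bder]
    rw [add_right_comm x t' t, ← add_assoc x t t']
    linear_combination (-fun1 x - fun1 (x + t) - fun1 (x + t')) * CharTwo.two_eq_zero (R := ZMod 2)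
  · intro s hs
    have hlow : ∀ f : BF 6, DegLT 2 f →
        ∃ t N, InTableSpan complTable N ∧ DegLT 2 (f + bder t fun1 + ofTable N) := by
      intro f hf
      refine ⟨0, 0, InTableSpan.zero _, ?_⟩
      convert hf using 1
      funext x
      simp only [ofTable_zero, Pi.add_apply, bder, add_zero, Pi.zero_apply]
      linear_combination fun1 x * CharTwo.two_eq_zero (R := ZMod 2)
    rcases hs.lt_or_eq with hs | hs
    · exact hlow _ ((degLT_monomial s).mono (by omega))
    · obtain ⟨i, j, rfl⟩ := Multiset.card_eq_two.1 hs
      have e : (fun x : Fin 6 → ZMod 2 => (({i, j} : Multiset (Fin 6)).map x).prod)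
          = fun x => x i * x j := by
        funext x; simp
      rw [e]
      rcases mul_coord_eq_bder_add i j with rfl | ⟨t, -, N, hN, h⟩
      · refine hlow _ ?_
        have hsq : ∀ a : ZMod 2, a * a = a := by decide
        simp only [hsq]
        exact degLT_coord i
      · refine ⟨t, N, ?_, ?_⟩
        · rcases List.mem_cons.1 hN with rfl | hN
          exacts [InTableSpan.zero _, InTableSpan.of_mem hN]
        · have h := fun x => forall_of_forall_table
            (P := fun x => x i * x j = bder t fun1 x + ofTable N x) h x
          have : (fun x : Fin 6 → ZMod 2 => x i * x j) = bder t fun1 + ofTable N := funext h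
          rw [this, add_assoc, bf_add_self]
          exact DegLT.zero _

lemma IsBent.translate {G : BF 6} (hG : IsBent G) (t : Fin 6 → ZMod 2) :
    IsBent (fun x => G (x + t)) := by
  intro l hl
  have e : (fun x => G (x + t)) + l = fun x => (G + fun y => l (y + t)) (x + t) := by
    funext x
    simp only [Pi.add_apply, add_assoc, vec_add_self, add_zero]
  rw [e, signSum_eq, wt_translate, ← signSum_eq]
  exact hG _ (hl.translate t)

lemma IsBent.add_affine {G l : BF 6} (hG : IsBent G) (hl : DegLT 2 l) : IsBent (G + l) := by
  intro l' hl'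
  rw [add_assoc]
  exact hG _ (hl.add hl')

lemma IsBent.eq_bentWord {N : ℕ} (hN : InTableSpan complTable N)
    (hB : IsBent (ofTable (fun1Tab cTab ^^^ N))) : fun1Tab cTab ^^^ N = bentWord := by
  obtain ⟨_, h⟩ := exists_of_checkSpan checkSpan_complTable hN
  rw [bentCheck, Bool.or_eq_true] at h
  rcases h with h | h
  · exact Nat.eq_of_beq_eq_true h
  · exfalso
    obtain ⟨a, -, h⟩ := List.any_eq_true.1 h
    have h1 := hB _ (degLT_linTab a)
    rw [← ofTable_xor, signSum_eq, wt_ofTable] at h1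
    rw [Bool.and_eq_true, Bool.not_eq_true', Bool.not_eq_true'] at h
    have h2 := Nat.ne_of_beq_eq_false h.1
    have h3 := Nat.ne_of_beq_eq_false h.2
    omega

lemma IsSpecial.exists_few {f : BF 6} (hf : IsSpecial f) :
    ∃ ψ : (Fin 6 → ZMod 2) → BF 6, ∀ q, DegLT 3 q → (∀ l, DegLT 2 l → 26 ≤ wt (f + q + l)) →
      ∃ t, DegLT 2 (q + ψ t) := by
  obtain ⟨σ, hσ, hr⟩ := hf
  set r := f ∘ σ + fun1 + pointInd 0 with hr_def
  refine ⟨fun t => (r + bder t fun1 + ofTable bentWord + fun1) ∘ σ.symm, fun q hq h => ?_⟩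
  have hrq : DegLT 3 (r + q ∘ σ) := hr.add (hq.comp hσ)
  have hB : IsBent (fun1 + (r + q ∘ σ)) := by
    refine isBent_of_pointInd (p := 0) (degLT_fun1.add hrq.succ).succ fun l hl => ?_
    have h1 := h _ (hl.comp hσ.symm)
    rw [← wt_comp_equiv _ σ] at h1
    convert h1 using 2
    funext x
    simp only [hr_def, Pi.add_apply, Function.comp_apply, Equiv.symm_apply_apply]
    linear_combination (fun1 x + pointInd 0 x) * CharTwo.two_eq_zero (R := ZMod 2)
  obtain ⟨t, N, hN, hdeg⟩ := exists_bder_add_table hrq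
  have hN' := IsBent.eq_bentWord hN (by
    convert ((hB.translate t).add_affine hdeg).add_affine (hrq.bder t) using 1
    funext x
    simp only [Pi.add_apply, Function.comp_apply, ofTable_xor, ofTable_fun1Tab_cTab, bder]
    linear_combination (-r (x + t) - q (σ (x + t)) - r x - q (σ x) - fun1 (x + t)) *
      CharTwo.two_eq_zero (R := ZMod 2))
  have hN'' := congrArg ofTable hN'
  rw [ofTable_xor, ofTable_fun1Tab_cTab] at hN''
  refine ⟨t, ?_⟩
  convert hdeg.comp hσ.symm using 1
  funext x
  simp only [← hN'', Pi.add_apply, Function.comp_apply, Equiv.apply_symm_apply]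
  linear_combination fun1 (σ.symm x) * CharTwo.two_eq_zero (R := ZMod 2)

end Counting

/-! ### Concatenation -/

section Concat

variable {n : ℕ}

lemma nl_le {r : ℕ} {f g : BF n} (hg : DegLT (r + 1) g) : nl r f ≤ wt (f + g) :=
  Nat.sInf_le ⟨g, mem_RM_iff.2 hg, (hd_eq_wt f g).symm⟩

lemma exists_wt_eq_nl (r : ℕ) (f : BF n) : ∃ g, DegLT (r + 1) g ∧ wt (f + g) = nl r f := by
  obtain ⟨g, hg, h⟩ := Nat.sInf_mem (s := {d | ∃ g ∈ RM r n, d = hd f g})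
    ⟨_, 0, mem_RM_iff.2 (DegLT.zero _), rfl⟩
  exact ⟨g, mem_RM_iff.1 hg, by rw [← hd_eq_wt]; exact h.symm⟩

lemma nl_concat_le {r : ℕ} (f₁ f₂ : BF n) {q l : BF n} (hq : DegLT (r + 1) q) (hl : DegLT r l) :
    nl r (concat f₁ f₂) ≤ wt (f₁ + q) + wt (f₂ + q + l) := by
  refine (nl_le (degLT_of_split hq hl)).trans_eq ?_
  have h0 : ∀ (x : Fin n → ZMod 2) (a : ZMod 2),
      (Fin.snoc x a : Fin (n + 1) → ZMod 2) ∘ Fin.castSucc = x := fun x a => by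
    funext i; simp
  have h2 : (1 + 1 : ZMod 2) = 0 := by decide
  rw [wt_eq_sum, wt_eq_sum, wt_eq_sum, sum_split_last, Finset.sum_add_distrib]
  simp only [concat, Pi.add_apply, Fin.init_snoc, Fin.snoc_last, h0, h2, zero_mul, add_zero,
    zero_add, one_mul, add_assoc]

lemma isSpecial_of_nl {f₁ f₂ : BF 6} (h₁ : nl 2 f₁ = 15) (h₂ : nl 2 f₂ = 15)
    (h : ∀ q, DegLT 3 q → wt (f₂ + q) = 15 → ∀ l, DegLT 2 l → 26 ≤ wt (f₁ + q + l)) :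
    IsSpecial f₁ := by
  obtain ⟨q₁, hq₁, e₁⟩ := exists_wt_eq_nl 2 f₁
  obtain ⟨q₂, hq₂, e₂⟩ := exists_wt_eq_nl 2 f₂
  exact isSpecial_of_isBent (fun q hq => h₁ ▸ nl_le hq) ⟨q₁, hq₁, e₁.trans h₁⟩
    ⟨q₂, hq₂, h q₂ hq₂ (e₂.trans h₂)⟩

end Concat

/-- If `nl_2(f1) = nl_2(f2) = 15` then `nl_2(f1||f2) ≤ 40`. -/
theorem stmt13 (f1 f2 : BF 6) (h1 : nl 2 f1 = 15) (h2 : nl 2 f2 = 15) :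
    nl 2 (concat f1 f2) ≤ 40 := by
  by_contra! hcon
  have key₁ : ∀ q, DegLT 3 q → wt (f1 + q) = 15 → ∀ l, DegLT 2 l → 26 ≤ wt (f2 + q + l) := by
    intro q hq hw l hl
    have := nl_concat_le f1 f2 hq hl
    omega
  have key₂ : ∀ q, DegLT 3 q → wt (f2 + q) = 15 → ∀ l, DegLT 2 l → 26 ≤ wt (f1 + q + l) := by
    intro q hq hw l hl
    have := nl_concat_le f1 f2 (hq.add hl.succ) hl
    rw [add_assoc f2, add_assoc q, bf_add_self, add_zero, ← add_assoc] at this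
    omega
  obtain ⟨φ, hφ, hφw, hφi⟩ := (isSpecial_of_nl h1 h2 key₂).exists_many
  obtain ⟨ψ, hψ⟩ := (isSpecial_of_nl h2 h1 key₁).exists_few
  choose t ht using fun i => hψ (φ i) (hφ i) (key₁ _ (hφ i) (hφw i))
  obtain ⟨i, j, hij, htij⟩ := Fintype.exists_ne_map_eq_of_card_lt t (by simp)
  refine hij (hφi i j ?_)
  have h := (ht i).add (ht j)
  rwa [htij, add_add_add_comm, bf_add_self, add_zero] at h
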